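/- arXiv:math/0006203 — 2 statements merged into one kernel-verified Lean document; each statement's English description precedes it below -/
import Mathlib

section
/- Under the Section 4 setup (pseudo-gradient flow φ for f on a Banach space E, index pair (N,L) with V = cl(N − L), f bounded on V, Palais–Smale in V, no critical points of f in L ∩ V), f has at least ν_H(N/L, {[L]}) critical points in V; that is, if f has exactly n critical points in V (n finite), then ν_H(N/L, {[L]}) ≤ n. -/
/-- The setoid on `N` collapsing the subset `L` to a single point, so that
`Quotient (collapse N L)` is the quotient space `N/L` with the quotient topology. -/
def collapse {X : Type*} (N L : Set X) : Setoid N where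
  r x y := x = y ∨ ((x : X) ∈ L ∧ (y : X) ∈ L)
  iseqv := by
    refine ⟨fun x => Or.inl rfl, ?_, ?_⟩
    · rintro x y (rfl | ⟨h1, h2⟩)
      · exact Or.inl rfl
      · exact Or.inr ⟨h2, h1⟩
    · rintro x y z (rfl | ⟨h1, h2⟩) (rfl | ⟨h3, h4⟩)
      · exact Or.inl rfl
      · exact Or.inr ⟨h3, h4⟩
      · exact Or.inr ⟨h1, h2⟩
      · exact Or.inr ⟨h1, h4⟩

open Set Filter Topology

section CollapseQuotient

variable {X : Type*} {N L : Set X}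

/-- A chosen representative of a point of the quotient `N/L`. -/
noncomputable def collapseRep (ξ : Quotient (collapse N L)) : X := (Quotient.out ξ : N)

theorem collapseRep_mem (ξ : Quotient (collapse N L)) : collapseRep ξ ∈ N :=
  (Quotient.out ξ).2

theorem mk_collapseRep (ξ : Quotient (collapse N L)) :
    Quotient.mk (collapse N L) ⟨collapseRep ξ, collapseRep_mem ξ⟩ = ξ :=
  Quotient.out_eq ξ

theorem collapseRep_mk (y : N) :
    collapseRep (Quotient.mk (collapse N L) y) = y ∨
      (collapseRep (Quotient.mk (collapse N L) y) ∈ L ∧ (y : X) ∈ L) := by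
  have h : (collapse N L).r (Quotient.out (Quotient.mk (collapse N L) y)) y :=
    Quotient.mk_out (s := collapse N L) y
  rcases h with h | h
  · exact Or.inl (congrArg Subtype.val h)
  · exact Or.inr h

theorem collapseRep_mk_of_notMem {y : N} (hy : (y : X) ∉ L) :
    collapseRep (Quotient.mk (collapse N L) y) = y :=
  (collapseRep_mk y).resolve_right fun h => hy h.2

theorem collapse_mk_eq_of_mem {y z : N} (hy : (y : X) ∈ L) (hz : (z : X) ∈ L) :
    Quotient.mk (collapse N L) y = Quotient.mk (collapse N L) z :=
  Quotient.sound (s := collapse N L) (Or.inr ⟨hy, hz⟩)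

theorem collapse_mk_ne {y z : N} (hy : (y : X) ∉ L) (hz : (z : X) ∈ L) :
    Quotient.mk (collapse N L) y ≠ Quotient.mk (collapse N L) z := fun h => by
  rcases (Quotient.exact (s := collapse N L) h : y = z ∨ ((y : X) ∈ L ∧ (z : X) ∈ L)) with h | h
  · exact hy (h ▸ hz)
  · exact hy h.1

theorem collapseRep_mk_mem_iff {A : Set X} (hA : L ⊆ A ∨ Disjoint A L) (y : N) :
    collapseRep (Quotient.mk (collapse N L) y) ∈ A ↔ (y : X) ∈ A := by
  rcases collapseRep_mk (N := N) (L := L) y with h | ⟨h1, h2⟩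
  · rw [h]
  · rcases hA with hA | hA
    · exact ⟨fun _ => hA h2, fun _ => hA h1⟩
    · exact ⟨fun h => (disjoint_left.1 hA h h1).elim, fun h => (disjoint_left.1 hA h h2).elim⟩

/-- The map `X → N/L` extending the quotient map by the constant `[l₀]` outside `N`. -/
noncomputable def collapseProj (N L : Set X) (l₀ : N) (y : X) : Quotient (collapse N L) :=
  open Classical in if h : y ∈ N then Quotient.mk _ ⟨y, h⟩ else Quotient.mk _ l₀

theorem collapseProj_of_mem (l₀ : N) {y : X} (h : y ∈ N) :
    collapseProj N L l₀ y = Quotient.mk _ ⟨y, h⟩ := by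
  simp [collapseProj, h]

theorem collapseProj_collapseRep (l₀ : N) (ξ : Quotient (collapse N L)) :
    collapseProj N L l₀ (collapseRep ξ) = ξ := by
  rw [collapseProj_of_mem l₀ (collapseRep_mem ξ), mk_collapseRep]

variable [TopologicalSpace X]

theorem continuousOn_collapseProj (l₀ : N) : ContinuousOn (collapseProj N L l₀) N := by
  rw [continuousOn_iff_continuous_domRestrict]
  convert (continuous_quotient_mk' : Continuous (Quotient.mk (collapse N L))) using 1
  ext y
  exact collapseProj_of_mem l₀ y.2

theorem isOpen_collapseRep_preimage {A : Set X} (hA : L ⊆ A ∨ Disjoint A L)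
    (hAo : IsOpen {y : N | (y : X) ∈ A}) :
    IsOpen {ξ : Quotient (collapse N L) | collapseRep ξ ∈ A} := by
  refine (isQuotientMap_quot_mk : IsQuotientMap (Quotient.mk (collapse N L))).isOpen_preimage.1 ?_
  convert hAo using 1
  ext y
  exact collapseRep_mk_mem_iff hA y

/-- A homotopy on a saturated open subset of `N` descends to the quotient `N/L`. -/
theorem continuousOn_collapse_prod {Z : Type*} [TopologicalSpace Z] {A : Set X}
    (hA : L ⊆ A ∨ Disjoint A L) (hAo : IsOpen {y : N | (y : X) ∈ A})
    {G : Quotient (collapse N L) × ℝ → Z} {g : X × ℝ → Z}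
    (hg : ContinuousOn g (A ×ˢ Icc (0 : ℝ) 1))
    (hG : ∀ y : N, (y : X) ∈ A → ∀ s ∈ Icc (0 : ℝ) 1, G (Quotient.mk _ y, s) = g (y, s)) :
    ContinuousOn G ({ξ | collapseRep ξ ∈ A} ×ˢ Icc (0 : ℝ) 1) := by
  set W : Set (Quotient (collapse N L)) := {ξ | collapseRep ξ ∈ A} with hW
  have hq : IsQuotientMap (W.restrictPreimage (Quotient.mk (collapse N L))) :=
    isQuotientMap_quot_mk.restrictPreimage_isOpen (isOpen_collapseRep_preimage hA hAo)
  have key : Continuous fun p : W × Icc (0 : ℝ) 1 => G (p.1, p.2) := by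
    refine hq.continuous_lift_prod_left ?_
    have hmem : ∀ y : Quotient.mk (collapse N L) ⁻¹' W, ((y : N) : X) ∈ A :=
      fun y => (collapseRep_mk_mem_iff hA _).1 y.2
    have : (fun p : (Quotient.mk (collapse N L) ⁻¹' W) × Icc (0 : ℝ) 1 =>
        G (W.restrictPreimage (Quotient.mk (collapse N L)) p.1, p.2)) =
        fun p => g (((p.1 : N) : X), (p.2 : ℝ)) := by
      ext p
      exact hG p.1 (hmem p.1) p.2 p.2.2
    rw [this]
    exact hg.comp_continuous (by fun_prop) fun p => ⟨hmem p.1, p.2.2⟩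
  rw [continuousOn_iff_continuous_domRestrict]
  exact key.comp (f := fun p : ↥(W ×ˢ Icc (0 : ℝ) 1) =>
    ((⟨p.1.1, p.2.1⟩, ⟨p.1.2, p.2.2⟩) : W × Icc (0 : ℝ) 1)) (by fun_prop)

end CollapseQuotient

theorem exists_continuousOn_forall_mem_convex {X : Type*} [MetricSpace X] {U : Set X}
    {C : X → Set ℝ} (hC : ∀ x ∈ U, Convex ℝ (C x))
    (H : ∀ x ∈ U, ∃ c, ∀ᶠ y in 𝓝[U] x, c ∈ C y) :
    ∃ T : X → ℝ, ContinuousOn T U ∧ ∀ x ∈ U, T x ∈ C x := by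
  obtain ⟨g, hg⟩ := exists_continuous_forall_mem_convex_of_local_const (X := U)
    (t := fun x => C x) (fun x => hC x x.2) fun x => by
      obtain ⟨c, hc⟩ := H x x.2
      refine ⟨c, ?_⟩
      rw [nhds_subtype_eq_comap_nhdsWithin]
      exact hc.comap _
  classical
  refine ⟨fun x => if h : x ∈ U then g ⟨x, h⟩ else 0, ?_, fun x hx => ?_⟩
  · rw [continuousOn_iff_continuous_domRestrict]
    convert g.continuous using 1
    ext x
    simp
  · simpa [hx] using hg ⟨x, hx⟩

section IndexPair

/-- The forward orbit of `y` up to time `t` stays in `M`. -/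
def StaysIn {X : Type*} (φ : ℝ → X → X) (M : Set X) (y : X) (t : ℝ) : Prop :=
  ∀ s ∈ Icc (0 : ℝ) t, φ s y ∈ M

theorem StaysIn.mono {X : Type*} {φ : ℝ → X → X} {M : Set X} {y : X} {t t' : ℝ}
    (h : StaysIn φ M y t') (htt : t ≤ t') : StaysIn φ M y t :=
  fun s hs => h s ⟨hs.1, hs.2.trans htt⟩

/-- The semiflow induced on `N/L`, as a map on `N`. -/
noncomputable def collapseFlow {X : Type*} (φ : ℝ → X → X) (N L : Set X) (l₀ : N) (p : X × ℝ) :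
    Quotient (collapse N L) :=
  open Classical in if StaysIn φ (N \ L) p.1 p.2 then collapseProj N L l₀ (φ p.2 p.1)
    else Quotient.mk _ l₀

/-- The part of an index pair `(N, L)` for a flow that governs forward orbits. -/
structure IsIndexPair {X : Type*} [TopologicalSpace X] (φ : ℝ → X → X) (N L : Set X) : Prop where
  continuous : Continuous fun p : ℝ × X => φ p.1 p.2
  zero : ∀ x, φ 0 x = x
  add : ∀ s t x, φ (s + t) x = φ s (φ t x)
  isClosed_fst : IsClosed N
  isClosed_snd : IsClosed L
  subset : L ⊆ N
  pos : ∀ x ∈ L, ∀ t ≥ (0 : ℝ), (∀ s ∈ Icc 0 t, φ s x ∈ N) → ∀ s ∈ Icc 0 t, φ s x ∈ L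
  exits : ∀ x ∈ N, ¬ (∀ t ≥ (0 : ℝ), φ t x ∈ N) →
    ∃ t ≥ (0 : ℝ), (∀ s ∈ Icc 0 t, φ s x ∈ N) ∧ φ t x ∈ L

variable {X : Type*} [TopologicalSpace X] {φ : ℝ → X → X} {N L : Set X}

namespace IsIndexPair

theorem continuous_apply (h : IsIndexPair φ N L) (t : ℝ) : Continuous (φ t) :=
  h.continuous.comp (Continuous.prodMk_right t)

theorem staysIn_add (h : IsIndexPair φ N L) {M : Set X} {y : X} {a b : ℝ}
    (ha : StaysIn φ M y a) (hb : StaysIn φ M (φ a y) b) : StaysIn φ M y (b + a) := by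
  intro s hs
  rcases le_total s a with hsa | hsa
  · exact ha s ⟨hs.1, hsa⟩
  · have := hb (s - a) ⟨by linarith, by linarith [hs.2]⟩
    rwa [← h.add, sub_add_cancel] at this

/-- Orbits starting in `N` leave `N \ L` only through `L`. -/
theorem staysIn_diff_iff (h : IsIndexPair φ N L) {y : X} (hy : y ∈ N) {t : ℝ} :
    StaysIn φ (N \ L) y t ↔ ∀ s ∈ Icc (0 : ℝ) t, φ s y ∉ L := by
  refine ⟨fun H s hs => (H s hs).2, fun H s hs => ⟨?_, H s hs⟩⟩
  by_contra hsN
  obtain ⟨t', ht', hN', hL'⟩ := h.exits y hy fun H' => hsN (H' s hs.1)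
  rcases le_total s t' with hst | hst
  · exact hsN (hN' s ⟨hs.1, hst⟩)
  · exact H t' ⟨ht', hst.trans hs.2⟩ hL'

theorem eventually_staysIn (h : IsIndexPair φ N L) {y : X} {t : ℝ}
    (H : StaysIn φ (N \ L) y t) (ht : 0 ≤ t) :
    ∀ᶠ p : X × ℝ in 𝓝[N ×ˢ Ici (0 : ℝ)] (y, t), StaysIn φ (N \ L) p.1 p.2 := by
  have hev : ∀ᶠ p : X × ℝ in 𝓝 (y, t), ∀ θ ∈ Icc (0 : ℝ) 1, φ (θ * p.2) p.1 ∉ L := by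
    refine isCompact_Icc.eventually_forall_of_forall_eventually
      (P := fun (p : X × ℝ) (θ : ℝ) => φ (θ * p.2) p.1 ∉ L) fun θ hθ => ?_
    have hc : Continuous fun z : (X × ℝ) × ℝ => φ (z.2 * z.1.2) z.1.1 :=
      h.continuous.comp (f := fun z : (X × ℝ) × ℝ => (z.2 * z.1.2, z.1.1)) (by fun_prop)
    refine hc.continuousAt.eventually (h.isClosed_snd.isOpen_compl.mem_nhds ?_)
    exact (H _ ⟨mul_nonneg hθ.1 ht, mul_le_of_le_one_left ht hθ.2⟩).2
  filter_upwards [hev.filter_mono nhdsWithin_le_nhds, self_mem_nhdsWithin] with p hp hpm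
  refine (h.staysIn_diff_iff hpm.1).2 fun s hs => ?_
  rcases (mem_Ici.1 hpm.2).eq_or_lt with h0 | h0
  · have hs0 : s = 0 := le_antisymm (hs.2.trans h0.ge) hs.1
    simpa [hs0] using hp 0 ⟨le_rfl, zero_le_one⟩
  · have := hp (s / p.2) ⟨div_nonneg hs.1 h0.le, (div_le_one h0).2 hs.2⟩
    rwa [div_mul_cancel₀ _ h0.ne'] at this

theorem eventually_staysIn_left (h : IsIndexPair φ N L) {y : X} {t : ℝ}
    (H : StaysIn φ (N \ L) y t) (ht : 0 ≤ t) :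
    ∀ᶠ y' in 𝓝[N] y, StaysIn φ (N \ L) y' t := by
  have hc : Tendsto (fun y' : X => (y', t)) (𝓝[N] y) (𝓝[N ×ˢ Ici (0 : ℝ)] (y, t)) :=
    tendsto_nhdsWithin_iff.2 ⟨(Continuous.prodMk_left t).continuousAt.mono_left
      nhdsWithin_le_nhds, eventually_mem_nhdsWithin.mono fun _ hy => ⟨hy, ht⟩⟩
  exact hc.eventually (h.eventually_staysIn H ht)

theorem continuousOn_collapseFlow (h : IsIndexPair φ N L) {l₀ : N} (hl₀ : (l₀ : X) ∈ L) :
    ContinuousOn (collapseFlow φ N L l₀) (N ×ˢ Ici (0 : ℝ)) := by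
  rintro ⟨y, t⟩ ⟨hy, ht⟩
  have ht : 0 ≤ t := ht
  have hy : y ∈ N := hy
  have hφ : Continuous fun p : X × ℝ => φ p.2 p.1 := h.continuous.comp continuous_swap
  by_cases H : StaysIn φ (N \ L) y t
  · have hev := h.eventually_staysIn H ht
    have h1 : ContinuousWithinAt (fun p : X × ℝ => collapseProj N L l₀ (φ p.2 p.1))
        (N ×ˢ Ici (0 : ℝ)) (y, t) := by
      have h2 : Tendsto (fun p : X × ℝ => φ p.2 p.1) (𝓝[N ×ˢ Ici (0 : ℝ)] (y, t))
          (𝓝[N] (φ t y)) := by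
        refine tendsto_nhdsWithin_iff.2 ⟨hφ.continuousAt.mono_left nhdsWithin_le_nhds, ?_⟩
        filter_upwards [hev, self_mem_nhdsWithin] with p hp hpm
        exact (hp p.2 ⟨hpm.2, le_rfl⟩).1
      exact (continuousOn_collapseProj l₀ _ (H t ⟨ht, le_rfl⟩).1).tendsto.comp h2
    refine h1.congr_of_eventuallyEq ?_ ?_
    · filter_upwards [hev] with p hp
      simp [collapseFlow, hp]
    · simp [collapseFlow, H]
  · have hval : collapseFlow φ N L l₀ (y, t) = Quotient.mk _ l₀ := by simp [collapseFlow, H]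
    rw [ContinuousWithinAt, hval]
    by_cases HN : StaysIn φ N y t
    · have htL : φ t y ∈ L := by
        have : ∃ s ∈ Icc (0 : ℝ) t, φ s y ∈ L := by
          by_contra hcon
          push Not at hcon
          exact H ((h.staysIn_diff_iff hy).2 hcon)
        obtain ⟨s, hs, hsL⟩ := this
        have := h.pos _ hsL (t - s) (by linarith [hs.2]) (fun r hr => by
          rw [← h.add]
          exact HN _ ⟨by linarith [hr.1, hs.1], by linarith [hr.2]⟩) (t - s)
            ⟨by linarith [hs.2], le_rfl⟩
        rwa [← h.add, sub_add_cancel] at this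
      intro O hO
      have h1 : ∀ᶠ z in 𝓝[N] (φ t y), collapseProj N L l₀ z ∈ O := by
        refine (continuousOn_collapseProj l₀ _ (h.subset htL)).eventually ?_
        rwa [collapseProj_of_mem l₀ (h.subset htL),
          collapse_mk_eq_of_mem (z := l₀) (by exact htL) hl₀]
      have h2 : ∀ᶠ p : X × ℝ in 𝓝[N ×ˢ Ici (0 : ℝ)] (y, t),
          φ p.2 p.1 ∈ N → collapseProj N L l₀ (φ p.2 p.1) ∈ O := by
        have h3 : Tendsto (fun p : X × ℝ => φ p.2 p.1) (𝓝[N ×ˢ Ici (0 : ℝ)] (y, t))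
            (𝓝 (φ t y)) := hφ.continuousAt.mono_left nhdsWithin_le_nhds
        exact h3.eventually (eventually_nhdsWithin_iff.1 h1)
      change ∀ᶠ p in 𝓝[N ×ˢ Ici (0 : ℝ)] (y, t), collapseFlow φ N L l₀ p ∈ O
      filter_upwards [h2, self_mem_nhdsWithin] with p hp hpm
      by_cases hs : StaysIn φ (N \ L) p.1 p.2
      · simpa [collapseFlow, hs] using hp (hs p.2 ⟨hpm.2, le_rfl⟩).1
      · simpa [collapseFlow, hs] using mem_of_mem_nhds hO
    · simp only [StaysIn] at HN
      push Not at HN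
      obtain ⟨s, hs, hsN⟩ := HN
      have hc : Continuous fun p : X × ℝ => φ (min s p.2) p.1 :=
        h.continuous.comp (f := fun p : X × ℝ => (min s p.2, p.1)) (by fun_prop)
      have h2 : ∀ᶠ p : X × ℝ in 𝓝 (y, t), φ (min s p.2) p.1 ∈ Nᶜ := by
        refine hc.continuousAt.eventually (h.isClosed_fst.isOpen_compl.mem_nhds ?_)
        simpa [min_eq_left hs.2] using hsN
      refine tendsto_const_nhds.congr' ?_
      filter_upwards [h2.filter_mono nhdsWithin_le_nhds, self_mem_nhdsWithin] with p hp hpm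
      have : ¬ StaysIn φ (N \ L) p.1 p.2 := fun H' =>
        hp (H' _ ⟨le_min hs.1 hpm.2, min_le_right _ _⟩).1
      simp [collapseFlow, this]

end IsIndexPair

end IndexPair

section Homotopies

theorem isOpen_coe_preimage_of_eventually {X : Type*} [TopologicalSpace X] {N A : Set X}
    (hA : ∀ y ∈ A, ∀ᶠ y' in 𝓝[N] y, y' ∈ A) : IsOpen {y : N | (y : X) ∈ A} := by
  refine isOpen_iff_mem_nhds.2 fun y hy => ?_
  rw [nhds_subtype_eq_comap_nhdsWithin]
  exact (hA y hy).comap _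

theorem IsIndexPair.exists_deformation_to_exit {X : Type*} [MetricSpace X] {φ : ℝ → X → X}
    {N L : Set X} (h : IsIndexPair φ N L) {l₀ : N} (hl₀ : (l₀ : X) ∈ L)
    (hloc : ∀ y ∈ N, (∃ t ≥ (0 : ℝ), ¬ StaysIn φ (N \ L) y t) →
      ∃ t ≥ (0 : ℝ), ∀ᶠ y' in 𝓝[N] y, ¬ StaysIn φ (N \ L) y' t) :
    ∃ W : Set (Quotient (collapse N L)), IsOpen W ∧
      (∀ y : N, (∃ t ≥ (0 : ℝ), ¬ StaysIn φ (N \ L) y t) → Quotient.mk _ y ∈ W) ∧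
      ∃ H : Quotient (collapse N L) × ℝ → Quotient (collapse N L),
        ContinuousOn H (W ×ˢ Icc (0 : ℝ) 1) ∧
        (∀ ξ ∈ W, ∀ s ∈ Icc (0 : ℝ) 1, H (ξ, s) ∈ W) ∧
        (∀ ξ ∈ W, H (ξ, 0) = ξ) ∧
        (∀ ξ ∈ W, H (ξ, 1) = Quotient.mk _ l₀) ∧
        (∀ s ∈ Icc (0 : ℝ) 1, H (Quotient.mk _ l₀, s) = Quotient.mk _ l₀) := by
  set A : Set X := {y | y ∈ N ∧ ∃ t ≥ (0 : ℝ), ¬ StaysIn φ (N \ L) y t} with hA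
  have hL0 : ∀ y ∈ L, ∀ t ≥ (0 : ℝ), ¬ StaysIn φ (N \ L) y t := fun y hy t ht H =>
    (H 0 ⟨le_rfl, ht⟩).2 (by rwa [h.zero])
  have hLA : L ⊆ A := fun y hy => ⟨h.subset hy, 0, le_rfl, hL0 y hy 0 le_rfl⟩
  have hAo : IsOpen {y : N | (y : X) ∈ A} := by
    refine isOpen_coe_preimage_of_eventually fun y hy => ?_
    obtain ⟨t, ht, hev⟩ := hloc y hy.1 hy.2
    filter_upwards [hev, self_mem_nhdsWithin] with y' hy' hyN
    exact ⟨hyN, t, ht, hy'⟩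
  obtain ⟨T, hTc, hT⟩ := exists_continuousOn_forall_mem_convex (U := A)
    (C := fun y => {t | 0 ≤ t ∧ ¬ StaysIn φ (N \ L) y t})
    (fun y _ => OrdConnected.convex ⟨fun a ha b _ c hc =>
      ⟨ha.1.trans hc.1, fun H => ha.2 (H.mono hc.1)⟩⟩)
    (fun y hy => by
      obtain ⟨t, ht, hev⟩ := hloc y hy.1 hy.2
      exact ⟨t, (hev.filter_mono (nhdsWithin_mono _ fun _ hz => hz.1)).mono
        fun _ hz => ⟨ht, hz⟩⟩)
  have hW : ∀ y : N, (y : X) ∈ A → Quotient.mk (collapse N L) y ∈ {ξ | collapseRep ξ ∈ A} :=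
    fun y hy => (collapseRep_mk_mem_iff (Or.inl hLA) y).2 hy
  have hLφ : ∀ y ∈ L, ∀ t ≥ (0 : ℝ), collapseFlow φ N L l₀ (y, t) = Quotient.mk _ l₀ :=
    fun y hy t ht => by simp [collapseFlow, hL0 y hy t ht]
  refine ⟨{ξ | collapseRep ξ ∈ A}, isOpen_collapseRep_preimage (Or.inl hLA) hAo,
    fun y hy => hW y ⟨y.2, hy⟩,
    fun p => collapseFlow φ N L l₀ (collapseRep p.1, p.2 * T (collapseRep p.1)), ?_, ?_, ?_, ?_, ?_⟩
  · refine continuousOn_collapse_prod (Or.inl hLA) hAo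
      (g := fun p : X × ℝ => collapseFlow φ N L l₀ (p.1, p.2 * T p.1)) ?_ ?_
    · refine (h.continuousOn_collapseFlow hl₀).comp (f := fun p : X × ℝ => (p.1, p.2 * T p.1))
        ?_ fun p hp => ⟨hp.1.1, mul_nonneg hp.2.1 (hT _ hp.1).1⟩
      exact continuousOn_fst.prodMk (continuousOn_snd.mul
        (hTc.comp continuousOn_fst fun p hp => hp.1))
    · intro y hy s hs
      rcases collapseRep_mk (L := L) y with h' | ⟨h1, h2⟩
      · simp only [h']
      · simp only
        rw [hLφ _ h1 _ (mul_nonneg hs.1 (hT _ (hLA h1)).1),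
          hLφ _ h2 _ (mul_nonneg hs.1 (hT _ hy).1)]
  · intro ξ hξ s hs
    have hTy := hT _ hξ
    by_cases H : StaysIn φ (N \ L) (collapseRep ξ) (s * T (collapseRep ξ))
    · have hmem := (H _ ⟨mul_nonneg hs.1 hTy.1, le_rfl⟩).1
      simp only [collapseFlow, if_pos H]
      rw [collapseProj_of_mem l₀ hmem]
      exact hW _ ⟨hmem, _, hTy.1, fun H' => hTy.2
        ((h.staysIn_add H H').mono (by nlinarith [hs.1, hTy.1]))⟩
    · simp only [collapseFlow, if_neg H]
      exact hW _ (hLA hl₀)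
  · intro ξ hξ
    simp only [zero_mul]
    by_cases hξL : collapseRep ξ ∈ L
    · rw [hLφ _ hξL 0 le_rfl, ← mk_collapseRep ξ]
      exact collapse_mk_eq_of_mem hl₀ hξL
    · have : StaysIn φ (N \ L) (collapseRep ξ) 0 := fun s hs => by
        rw [le_antisymm hs.2 hs.1, h.zero]
        exact ⟨collapseRep_mem ξ, hξL⟩
      simp [collapseFlow, this, h.zero, collapseProj_collapseRep]
  · intro ξ hξ
    simp [collapseFlow, (hT _ hξ).2]
  · intro s hs
    have hL' : collapseRep (Quotient.mk (collapse N L) l₀) ∈ L :=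
      (collapseRep_mk_mem_iff (Or.inl subset_rfl) l₀).2 hl₀
    exact hLφ _ hL' _ (mul_nonneg hs.1 (hT _ (hLA hL')).1)

theorem IsIndexPair.exists_contraction_to_ball {E : Type*} [NormedAddCommGroup E]
    [NormedSpace ℝ E] {φ : ℝ → E → E}
    {N L : Set E} (h : IsIndexPair φ N L) {l₀ : N} (hl₀ : (l₀ : E) ∈ L) {x : E} {r R : ℝ}
    (hR : 0 < R) (hball : Metric.ball x R ⊆ N \ L)
    (hstay : ∀ y a b t, a ≤ t → t ≤ b → φ a y ∈ Metric.ball x r → φ b y ∈ Metric.ball x r →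
      φ t y ∈ Metric.ball x R) :
    ∃ W : Set (Quotient (collapse N L)), IsOpen W ∧
      (∀ y : N, (∃ t ≥ (0 : ℝ), StaysIn φ (N \ L) y t ∧ φ t y ∈ Metric.ball x r) →
        Quotient.mk _ y ∈ W) ∧
      W ⊆ {ξ | ξ ≠ Quotient.mk _ l₀} ∧
      ∃ K : Quotient (collapse N L) × ℝ → Quotient (collapse N L),
        ∃ ξ₀ : Quotient (collapse N L), ξ₀ ≠ Quotient.mk _ l₀ ∧
        ContinuousOn K (W ×ˢ Icc (0 : ℝ) 1) ∧
        (∀ ξ ∈ W, ∀ s ∈ Icc (0 : ℝ) 1, K (ξ, s) ≠ Quotient.mk _ l₀) ∧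
        (∀ ξ ∈ W, K (ξ, 0) = ξ) ∧
        (∀ ξ ∈ W, K (ξ, 1) = ξ₀) := by
  set A : Set E := {y | y ∈ N ∧ ∃ t ≥ (0 : ℝ), StaysIn φ (N \ L) y t ∧ φ t y ∈ Metric.ball x r}
    with hA
  have hdisj : Disjoint A L := disjoint_left.2 fun y hy hyL => by
    obtain ⟨-, t, ht, hs, -⟩ := hy
    exact (hs 0 ⟨le_rfl, ht⟩).2 (by rwa [h.zero])
  have hloc : ∀ y t, 0 ≤ t → StaysIn φ (N \ L) y t → φ t y ∈ Metric.ball x r →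
      ∀ᶠ y' in 𝓝[N] y, StaysIn φ (N \ L) y' t ∧ φ t y' ∈ Metric.ball x r := fun y t ht hs hb =>
    (h.eventually_staysIn_left hs ht).and (((h.continuous_apply t).continuousAt.eventually
      (Metric.isOpen_ball.mem_nhds hb)).filter_mono nhdsWithin_le_nhds)
  have hAo : IsOpen {y : N | (y : E) ∈ A} := by
    refine isOpen_coe_preimage_of_eventually fun y hy => ?_
    obtain ⟨-, t, ht, hs, hb⟩ := hy
    filter_upwards [hloc y t ht hs hb, self_mem_nhdsWithin] with y' hy' hyN
    exact ⟨hyN, t, ht, hy'⟩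
  obtain ⟨T, hTc, hT⟩ := exists_continuousOn_forall_mem_convex (U := A)
    (C := fun y => {t | ∃ a b, 0 ≤ a ∧ a ≤ t ∧ t ≤ b ∧ StaysIn φ (N \ L) y b ∧
      φ a y ∈ Metric.ball x r ∧ φ b y ∈ Metric.ball x r})
    (fun y _ => OrdConnected.convex ⟨by
      rintro t ⟨a, -, ha0, hat, -, -, haB, -⟩ t' ⟨-, b, -, -, htb, hs, -, hbB⟩ c hc
      exact ⟨a, b, ha0, hat.trans hc.1, hc.2.trans htb, hs, haB, hbB⟩⟩)
    (fun y hy => by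
      obtain ⟨-, t, ht, hs, hb⟩ := hy
      exact ⟨t, ((hloc y t ht hs hb).filter_mono (nhdsWithin_mono _ fun _ hz => hz.1)).mono
        fun _ hz => ⟨t, t, ht, le_rfl, le_rfl, hz.1, hz.2, hz.2⟩⟩)
  have hT0 : ∀ y ∈ A, 0 ≤ T y := fun y hy => by
    obtain ⟨a, b, ha, hat, -⟩ := hT y hy
    exact ha.trans hat
  have hTs : ∀ y ∈ A, StaysIn φ (N \ L) y (T y) := fun y hy => by
    obtain ⟨a, b, -, -, htb, hs, -⟩ := hT y hy
    exact hs.mono htb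
  have hTb : ∀ y ∈ A, φ (T y) y ∈ Metric.ball x R := fun y hy => by
    obtain ⟨a, b, -, hat, htb, -, haB, hbB⟩ := hT y hy
    exact hstay y a b _ hat htb haB hbB
  set g : E × ℝ → E := fun p =>
    x + min 1 (2 - 2 * p.2) • (φ (min (2 * p.2) 1 * T p.1) p.1 - x) with hg
  have hgc : ContinuousOn g (A ×ˢ Icc (0 : ℝ) 1) := by
    have hTc' : ContinuousOn (fun p : E × ℝ => T p.1) (A ×ˢ Icc (0 : ℝ) 1) :=
      hTc.comp continuousOn_fst fun p hp => hp.1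
    have h1 : ContinuousOn (fun p : E × ℝ => φ (min (2 * p.2) 1 * T p.1) p.1)
        (A ×ˢ Icc (0 : ℝ) 1) :=
      h.continuous.comp_continuousOn (f := fun p : E × ℝ => (min (2 * p.2) 1 * T p.1, p.1))
        (((by fun_prop : Continuous fun p : E × ℝ => min (2 * p.2) 1).continuousOn.mul
          hTc').prodMk continuousOn_fst)
    exact continuousOn_const.add
      ((by fun_prop : Continuous fun p : E × ℝ => min 1 (2 - 2 * p.2)).continuousOn.smul
        (h1.sub continuousOn_const))
  have hgm : ∀ y ∈ A, ∀ s ∈ Icc (0 : ℝ) 1, g (y, s) ∈ N \ L := by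
    intro y hy s hs
    rcases le_total s (1 / 2) with h2 | h2
    · have e1 : min 1 (2 - 2 * s) = 1 := min_eq_left (by linarith)
      have e2 : min (2 * s) 1 = 2 * s := min_eq_left (by linarith)
      simp only [hg, e1, e2, one_smul, add_sub_cancel]
      refine hTs y hy _ ⟨mul_nonneg (by linarith [hs.1]) (hT0 y hy), ?_⟩
      exact mul_le_of_le_one_left (hT0 y hy) (by linarith)
    · have e1 : min 1 (2 - 2 * s) = 2 - 2 * s := min_eq_right (by linarith)
      have e2 : min (2 * s) 1 = 1 := min_eq_right (by linarith)
      simp only [hg, e1, e2, one_mul]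
      refine hball ((convex_ball x R).add_smul_sub_mem (Metric.mem_ball_self hR) (hTb y hy)
        ⟨by linarith [hs.2], by linarith⟩)
  have hne : ∀ y (hy : y ∈ N \ L), collapseProj N L l₀ y ≠ Quotient.mk _ l₀ := fun y hy => by
    rw [collapseProj_of_mem l₀ hy.1]
    exact collapse_mk_ne hy.2 hl₀
  have hgN : MapsTo g (A ×ˢ Icc (0 : ℝ) 1) N := fun p hp => (hgm p.1 hp.1 p.2 hp.2).1
  refine ⟨{ξ | collapseRep ξ ∈ A}, isOpen_collapseRep_preimage (Or.inr hdisj) hAo,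
    fun y hy => (collapseRep_mk_mem_iff (Or.inr hdisj) y).2 ⟨y.2, hy⟩, ?_,
    fun p => collapseProj N L l₀ (g (collapseRep p.1, p.2)), collapseProj N L l₀ x,
    hne x (hball (Metric.mem_ball_self hR)), ?_, ?_, ?_, ?_⟩
  · rintro ξ hξ rfl
    exact disjoint_left.1 hdisj ((collapseRep_mk_mem_iff (Or.inr hdisj) l₀).1 hξ) hl₀
  · refine continuousOn_collapse_prod (Or.inr hdisj) hAo
      (g := fun p => collapseProj N L l₀ (g p))
      ((continuousOn_collapseProj l₀).comp hgc hgN) fun y hy s hs => ?_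
    simp only [collapseRep_mk_of_notMem (disjoint_left.1 hdisj hy)]
  · exact fun ξ hξ s hs => hne _ (hgm _ hξ s hs)
  · intro ξ hξ
    simp [hg, h.zero, collapseProj_collapseRep]
  · intro ξ hξ
    simp [hg]

end Homotopies

section PseudoGradient

variable {E : Type*} [NormedAddCommGroup E] [NormedSpace ℝ E]

/-- `φ` is a flow of a bounded pseudo-gradient vector field `Y` for `f`. -/
structure IsPseudoGradientFlow (f : E → ℝ) (α : ℝ → ℝ) (Y : E → E) (φ : ℝ → E → E) : Prop where
  contDiff : ContDiff ℝ 1 f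
  strictMonoOn : StrictMonoOn α (Ici 0)
  zero_rate : α 0 = 0
  bounded : ∃ C, ∀ x, ‖Y x‖ ≤ C
  rate_le : ∀ x, α ‖fderiv ℝ f x‖ ≤ fderiv ℝ f x (Y x)
  eq_zero : ∀ x, fderiv ℝ f x = 0 → Y x = 0
  continuous : Continuous fun p : ℝ × E => φ p.1 p.2
  zero : ∀ x, φ 0 x = x
  add : ∀ s t x, φ (s + t) x = φ s (φ t x)
  hasDerivAt : ∀ x t, HasDerivAt (fun s : ℝ => φ s x) (Y (φ t x)) t

/-- `f` is bounded on the closed set `V` and satisfies the Palais–Smale condition there. -/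
structure IsPalaisSmaleOn (f : E → ℝ) (V : Set E) : Prop where
  isClosed : IsClosed V
  bounded : ∃ C, ∀ x ∈ V, |f x| ≤ C
  exists_subseq : ∀ u : ℕ → E, (∀ n, u n ∈ V) → (∃ C, ∀ n, |f (u n)| ≤ C) →
    Tendsto (fun n => ‖fderiv ℝ f (u n)‖) atTop (𝓝 0) →
    ∃ x : E, ∃ σ : ℕ → ℕ, StrictMono σ ∧ Tendsto (u ∘ σ) atTop (𝓝 x)

variable {f : E → ℝ} {α : ℝ → ℝ} {Y : E → E} {φ : ℝ → E → E} {V : Set E}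

theorem IsPalaisSmaleOn.exists_critical (h : IsPalaisSmaleOn f V) (hf : ContDiff ℝ 1 f)
    {u : ℕ → E} (huV : ∀ n, u n ∈ V)
    (hu : ∀ n, ‖fderiv ℝ f (u n)‖ ≤ 1 / ((n : ℝ) + 1)) :
    ∃ z ∈ V, fderiv ℝ f z = 0 ∧ ∃ σ : ℕ → ℕ, StrictMono σ ∧ Tendsto (u ∘ σ) atTop (𝓝 z) := by
  have hlim : Tendsto (fun n => ‖fderiv ℝ f (u n)‖) atTop (𝓝 0) :=
    squeeze_zero (fun _ => norm_nonneg _) hu tendsto_one_div_add_atTop_nhds_zero_nat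
  obtain ⟨C, hC⟩ := h.bounded
  obtain ⟨z, σ, hσ, hz⟩ := h.exists_subseq u huV ⟨C, fun n => hC _ (huV n)⟩ hlim
  refine ⟨z, h.isClosed.mem_of_tendsto hz (Eventually.of_forall fun n => huV _), ?_, σ, hσ, hz⟩
  have hc : Continuous fun y => ‖fderiv ℝ f y‖ := (hf.continuous_fderiv one_ne_zero).norm
  exact norm_eq_zero.1 (tendsto_nhds_unique ((hc.tendsto z).comp hz)
    (hlim.comp hσ.tendsto_atTop))

/-- A closed subset of `V` free of critical points carries a uniform lower bound for the
derivative. -/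
theorem IsPalaisSmaleOn.exists_pos_le_norm_fderiv (h : IsPalaisSmaleOn f V)
    (hf : ContDiff ℝ 1 f) {S : Set E} (hS : IsClosed S) (hSV : S ⊆ V)
    (hcrit : ∀ z ∈ S, fderiv ℝ f z ≠ 0) :
    ∃ m > 0, ∀ z ∈ S, m ≤ ‖fderiv ℝ f z‖ := by
  by_contra! hcon
  choose u huS hu using fun n : ℕ => hcon (1 / ((n : ℝ) + 1)) (by positivity)
  obtain ⟨z, -, hz0, σ, -, hz⟩ := h.exists_critical hf (fun n => hSV (huS n)) fun n => (hu n).le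
  exact hcrit z (hS.mem_of_tendsto hz (Eventually.of_forall fun n => huS _)) hz0

namespace IsPseudoGradientFlow

theorem rate_pos (h : IsPseudoGradientFlow f α Y φ) {m : ℝ} (hm : 0 < m) : 0 < α m := by
  simpa [h.zero_rate] using h.strictMonoOn self_mem_Ici hm.le hm

theorem rate_nonneg (h : IsPseudoGradientFlow f α Y φ) {m : ℝ} (hm : 0 ≤ m) : 0 ≤ α m := by
  rcases hm.eq_or_lt with rfl | hm
  · exact h.zero_rate.ge
  · exact (h.rate_pos hm).le

theorem hasDerivAt_comp (h : IsPseudoGradientFlow f α Y φ) (y : E) (t : ℝ) :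
    HasDerivAt (fun s => f (φ s y)) (fderiv ℝ f (φ t y) (Y (φ t y))) t :=
  ((h.contDiff.differentiable one_ne_zero _).hasFDerivAt).comp_hasDerivAt t (h.hasDerivAt y t)

theorem monotone_comp (h : IsPseudoGradientFlow f α Y φ) (y : E) :
    Monotone fun s => f (φ s y) :=
  monotone_of_deriv_nonneg (fun t => (h.hasDerivAt_comp y t).differentiableAt) fun t => by
    rw [(h.hasDerivAt_comp y t).deriv]
    exact (h.rate_nonneg (norm_nonneg _)).trans (h.rate_le _)

theorem mul_sub_le (h : IsPseudoGradientFlow f α Y φ) {y : E} {a b m : ℝ} (hm : 0 ≤ m)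
    (hab : a ≤ b) (hfd : ∀ t ∈ Icc a b, m ≤ ‖fderiv ℝ f (φ t y)‖) :
    α m * (b - a) ≤ f (φ b y) - f (φ a y) := by
  have hd : Differentiable ℝ fun s => f (φ s y) :=
    fun t => (h.hasDerivAt_comp y t).differentiableAt
  refine (convex_Icc a b).mul_sub_le_image_sub_of_le_deriv hd.continuous.continuousOn
    hd.differentiableOn (fun t ht => ?_) a ⟨le_rfl, hab⟩ b ⟨hab, le_rfl⟩ hab
  rw [(h.hasDerivAt_comp y t).deriv]
  exact (h.strictMonoOn.monotoneOn hm (norm_nonneg _) (hfd t (interior_subset ht))).trans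
    (h.rate_le _)

theorem norm_sub_le {C : ℝ} (h : IsPseudoGradientFlow f α Y φ) (hC : ∀ x, ‖Y x‖ ≤ C) (y : E)
    {a b : ℝ} (hab : a ≤ b) : ‖φ b y - φ a y‖ ≤ C * (b - a) :=
  norm_image_sub_le_of_norm_deriv_le_segment' (f := fun s => φ s y)
    (fun t _ => (h.hasDerivAt y t).hasDerivWithinAt) (fun _ _ => hC _) b ⟨hab, le_rfl⟩

/-- A forward orbit that stays in `V` accumulates at a rest point of the flow. -/
theorem exists_rest_point (h : IsPseudoGradientFlow f α Y φ) (hV : IsPalaisSmaleOn f V) {y : E}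
    (hy : ∀ t ≥ (0 : ℝ), φ t y ∈ V) :
    ∃ z ∈ V, fderiv ℝ f z = 0 ∧ (∀ t, φ t z = z) ∧
      z ∈ closure ((fun t => φ t y) '' Ici 0) := by
  obtain ⟨C, hC⟩ := hV.bounded
  have hC' : ∀ t, f (φ t y) ≤ C := fun t =>
    (h.monotone_comp y (le_max_left t 0)).trans ((le_abs_self _).trans
      (hC _ (hy _ (le_max_right t 0))))
  have hex : ∀ k : ℕ, ∃ t ≥ (k : ℝ), ‖fderiv ℝ f (φ t y)‖ ≤ 1 / ((k : ℝ) + 1) := by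
    intro k
    by_contra! hcon
    have hm : (0 : ℝ) < 1 / ((k : ℝ) + 1) := by positivity
    have hα := h.rate_pos hm
    set c := α (1 / ((k : ℝ) + 1)) with hc
    set D := C - f (φ k y) + 1 with hD
    have hDpos : 0 < D := by linarith [hC' k]
    have hgrow := h.mul_sub_le (y := y) (a := k) (b := k + D / c) hm.le
      (by have := div_pos hDpos hα; linarith) fun t ht => (hcon t ht.1).le
    have : c * (k + D / c - k) = D := by field_simp; ring
    rw [← hc, this] at hgrow
    linarith [hC' (k + D / c)]
  choose t htk ht using hex
  have ht0 : ∀ k, 0 ≤ t k := fun k => (Nat.cast_nonneg k).trans (htk k)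
  obtain ⟨z, hzV, hz0, σ, hσ, hz⟩ := hV.exists_critical h.contDiff
    (u := fun k => φ (t k) y) (fun k => hy _ (ht0 k)) ht
  refine ⟨z, hzV, hz0, ?_, mem_closure_of_tendsto hz
    (Eventually.of_forall fun k => ⟨t (σ k), ht0 _, rfl⟩)⟩
  have hlim := tendsto_atTop_ciSup (h.monotone_comp y) ⟨C, by rintro _ ⟨s, rfl⟩; exact hC' s⟩
  set c := ⨆ s, f (φ s y)
  have htt : Tendsto (fun k => t (σ k)) atTop atTop :=
    (tendsto_atTop_mono htk tendsto_natCast_atTop_atTop).comp hσ.tendsto_atTop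
  have hconst : ∀ s, f (φ s z) = c := fun s => by
    have hcs : Continuous fun w => f (φ s w) :=
      h.contDiff.continuous.comp (h.continuous.comp (Continuous.prodMk_right s))
    refine tendsto_nhds_unique ((hcs.tendsto z).comp hz) ?_
    have := hlim.comp (tendsto_atTop_add_const_left atTop s htt)
    refine this.congr fun k => ?_
    simp [h.add]
  have hY : ∀ s, Y (φ s z) = 0 := fun s => by
    refine h.eq_zero _ ?_
    by_contra hne
    have h1 := h.hasDerivAt_comp z s
    simp only [hconst] at h1
    have h2 := h1.unique (hasDerivAt_const s c)
    have h3 := h.rate_le (φ s z)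
    exact absurd (h.rate_pos (norm_pos_iff.2 hne)) (by linarith)
  intro s
  have hd : ∀ r, HasDerivAt (fun s => φ s z) 0 r := fun r => hY r ▸ h.hasDerivAt z r
  have := is_const_of_deriv_eq_zero (fun r => (hd r).differentiableAt) (fun r => (hd r).deriv) s 0
  simpa [h.zero] using this

/-- Orbit segments with both ends close to an isolated critical point stay near it. -/
theorem exists_ball_stay (h : IsPseudoGradientFlow f α Y φ) (hV : IsPalaisSmaleOn f V) {x : E}
    {R : ℝ} (hR : 0 < R) (hRV : Metric.closedBall x R ⊆ V)
    (hcrit : ∀ z ∈ Metric.closedBall x R, fderiv ℝ f z = 0 → z = x) :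
    ∃ r > 0, ∀ y a b t, a ≤ t → t ≤ b → φ a y ∈ Metric.ball x r → φ b y ∈ Metric.ball x r →
      φ t y ∈ Metric.ball x R := by
  set S : Set E := {z | R / 2 ≤ dist z x ∧ dist z x ≤ R} with hS
  have hdc : Continuous fun z => dist z x := continuous_id.dist continuous_const
  have hSc : IsClosed S :=
    (isClosed_le continuous_const hdc).inter (isClosed_le hdc continuous_const)
  obtain ⟨m, hm, hmS⟩ := hV.exists_pos_le_norm_fderiv h.contDiff hSc (fun z hz => hRV hz.2)
    fun z hz hz0 => by
      have := hcrit z hz.2 hz0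
      subst this
      have := hz.1
      rw [dist_self] at this
      linarith
  obtain ⟨C₀, hC₀⟩ := h.bounded
  set C := max C₀ 1
  have hCpos : 0 < C := zero_lt_one.trans_le (le_max_right _ _)
  have hC : ∀ z, ‖Y z‖ ≤ C := fun z => (hC₀ z).trans (le_max_left _ _)
  have hα := h.rate_pos hm
  set κ := α m * (R / 2 / C) with hκ
  have hκpos : 0 < κ := by positivity
  obtain ⟨δ, hδ, hδf⟩ := Metric.continuousAt_iff.1 (h.contDiff.continuous.continuousAt (x := x))
    (κ / 2) (half_pos hκpos)
  refine ⟨min δ (R / 2), lt_min hδ (half_pos hR), fun y a b t hat htb ha hb => ?_⟩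
  by_contra htR
  have ha' : dist (φ a y) x < δ ∧ dist (φ a y) x < R / 2 := lt_min_iff.1 ha
  have hb' : dist (φ b y) x < δ := (lt_min_iff.1 hb).1
  have ht' : R ≤ dist (φ t y) x := not_lt.1 htR
  set g : ℝ → ℝ := fun s => dist (φ s y) x with hg
  have hgc : Continuous g :=
    (h.continuous.comp (Continuous.prodMk_left y)).dist continuous_const
  obtain ⟨c, ⟨hcI, hcg⟩, hcmax⟩ :=
    (isCompact_Icc.inter_right (isClosed_le hgc continuous_const) :
      IsCompact (Icc a t ∩ {s | g s ≤ R / 2})).exists_isGreatest ⟨a, ⟨le_rfl, hat⟩, ha'.2.le⟩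
  obtain ⟨d, ⟨hdI, hdg⟩, hdmin⟩ :=
    (isCompact_Icc.inter_right (isClosed_le continuous_const hgc) :
      IsCompact (Icc c t ∩ {s | R ≤ g s})).exists_isLeast ⟨t, ⟨hcI.2, le_rfl⟩, ht'⟩
  have hcg : g c ≤ R / 2 := hcg
  have hdg : R ≤ g d := hdg
  have hlow : ∀ s ∈ Ioc c d, R / 2 ≤ g s := fun s hs => by
    by_contra! hlt
    exact absurd (hcmax ⟨⟨hcI.1.trans hs.1.le, hs.2.trans hdI.2⟩, hlt.le⟩) (not_le.2 hs.1)
  have hupp : ∀ s ∈ Ico c d, g s ≤ R := fun s hs => by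
    by_contra! hlt
    exact absurd (hdmin ⟨⟨hs.1, hs.2.le.trans hdI.2⟩, hlt.le⟩) (not_le.2 hs.2)
  have hcd : c < d := lt_of_le_of_ne hdI.1 fun e => by subst e; linarith
  have hlow' : ∀ s ∈ Icc c d, R / 2 ≤ g s := by
    have : closure (Ioc c d) ⊆ {s | R / 2 ≤ g s} :=
      closure_minimal hlow (isClosed_le continuous_const hgc)
    rwa [closure_Ioc hcd.ne] at this
  have hupp' : ∀ s ∈ Icc c d, g s ≤ R := by
    have : closure (Ico c d) ⊆ {s | g s ≤ R} :=
      closure_minimal hupp (isClosed_le hgc continuous_const)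
    rwa [closure_Ico hcd.ne] at this
  have hgrow := h.mul_sub_le (y := y) hm.le hcd.le fun s hs => hmS _ ⟨hlow' s hs, hupp' s hs⟩
  have hspeed : R / 2 ≤ C * (d - c) := by
    have h1 := h.norm_sub_le hC y hcd.le
    rw [← dist_eq_norm] at h1
    have h2 : g d ≤ dist (φ d y) (φ c y) + g c := dist_triangle _ _ _
    linarith
  have hκle : κ ≤ α m * (d - c) :=
    mul_le_mul_of_nonneg_left ((div_le_iff₀' hCpos).2 hspeed) hα.le
  have h1 : f (φ a y) ≤ f (φ c y) := h.monotone_comp y hcI.1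
  have h2 : f (φ d y) ≤ f (φ b y) := h.monotone_comp y (hdI.2.trans htb)
  have h3 := abs_lt.1 (hδf ha'.1)
  have h4 := abs_lt.1 (hδf hb')
  linarith [h3.1, h4.2]

end IsPseudoGradientFlow

end PseudoGradient

theorem stmt18
    {E : Type*} [NormedAddCommGroup E] [NormedSpace ℝ E] [CompleteSpace E]
    (f : E → ℝ) (hf : ContDiff ℝ 1 f)
    -- α : [0,∞) → [0,∞) is strictly increasing and continuous with α(0) = 0
    (α : ℝ → ℝ) (hα1 : StrictMonoOn α (Set.Ici 0))
    (hα2 : ContinuousOn α (Set.Ici 0)) (hα3 : α 0 = 0)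
    (hα4 : ∀ r : ℝ, 0 ≤ r → 0 ≤ α r)
    -- Y is a pseudo-gradient vector field for f
    (Y : E → E) (hYb : ∃ C, ∀ x, ‖Y x‖ ≤ C)
    (hYg : ∀ x, α ‖fderiv ℝ f x‖ ≤ fderiv ℝ f x (Y x))
    (hY0 : ∀ x, fderiv ℝ f x = 0 → Y x = 0)
    -- φ is the flow of Y
    (φ : ℝ → E → E)
    (hφc : Continuous fun p : ℝ × E => φ p.1 p.2)
    (hφ0 : ∀ x, φ 0 x = x)
    (hφadd : ∀ s t x, φ (s + t) x = φ s (φ t x))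
    (hφode : ∀ x t, HasDerivAt (fun s : ℝ => φ s x) (Y (φ t x)) t)
    -- (N, L) is an index pair: closed, (i), (ii), cl(N − L) isolating
    (N L : Set E) (hN : IsClosed N) (hL : IsClosed L) (hLN : L ⊆ N)
    (hpos : ∀ x ∈ L, ∀ t ≥ (0 : ℝ), (∀ s ∈ Set.Icc 0 t, φ s x ∈ N) →
      ∀ s ∈ Set.Icc 0 t, φ s x ∈ L)
    (hexit : ∀ x ∈ N, ¬ (∀ t ≥ (0 : ℝ), φ t x ∈ N) →
      ∃ t ≥ (0 : ℝ), (∀ s ∈ Set.Icc 0 t, φ s x ∈ N) ∧ φ t x ∈ L)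
    (hiso : ∀ x ∈ closure (N \ L), (∀ t : ℝ, φ t x ∈ closure (N \ L)) →
      x ∈ interior (closure (N \ L)))
    -- f is bounded on V = cl(N − L)
    (hfb : ∃ C, ∀ x ∈ closure (N \ L), |f x| ≤ C)
    -- f satisfies the Palais–Smale condition in V
    (hPS : ∀ u : ℕ → E, (∀ n, u n ∈ closure (N \ L)) →
      (∃ C, ∀ n, |f (u n)| ≤ C) →
      Filter.Tendsto (fun n => ‖fderiv ℝ f (u n)‖) Filter.atTop (nhds 0) →
      ∃ x : E, ∃ σ : ℕ → ℕ, StrictMono σ ∧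
        Filter.Tendsto (u ∘ σ) Filter.atTop (nhds x))
    -- f has no critical points in L ∩ V
    (hnc : ∀ x ∈ L ∩ closure (N \ L), fderiv ℝ f x ≠ 0)
    (n : ℕ)
    -- x 1, …, x n are exactly the critical points of f in V
    (x : Fin n → E) (hxinj : Function.Injective x)
    (hcrit : ∀ z : E, (z ∈ closure (N \ L) ∧ fderiv ℝ f z = 0) ↔ ∃ i, x i = z)
    (l₀ : E) (hl₀ : l₀ ∈ L) :
    -- ν_H(N/L, {[L]}) ≤ n : an open cover W 0, …, W n of N/L such that {[L]} is a
    -- deformation retract of W 0 and each W i (i ≥ 1) misses [L] and is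
    -- contractible in (N/L) − {[L]}
    ∃ W : Fin (n + 1) → Set (Quotient (collapse N L)),
      (∀ i, IsOpen (W i)) ∧ (⋃ i, W i) = Set.univ ∧
      Quotient.mk (collapse N L) ⟨l₀, hLN hl₀⟩ ∈ W 0 ∧
      (∃ H : Quotient (collapse N L) × ℝ → Quotient (collapse N L),
        ContinuousOn H (W 0 ×ˢ Set.Icc (0 : ℝ) 1) ∧
        (∀ ξ ∈ W 0, ∀ s ∈ Set.Icc (0 : ℝ) 1, H (ξ, s) ∈ W 0) ∧
        (∀ ξ ∈ W 0, H (ξ, 0) = ξ) ∧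
        (∀ ξ ∈ W 0, H (ξ, 1) = Quotient.mk (collapse N L) ⟨l₀, hLN hl₀⟩) ∧
        (∀ s ∈ Set.Icc (0 : ℝ) 1,
          H (Quotient.mk (collapse N L) ⟨l₀, hLN hl₀⟩, s) =
            Quotient.mk (collapse N L) ⟨l₀, hLN hl₀⟩)) ∧
      (∀ i : Fin n,
        W i.succ ⊆ {ξ | ξ ≠ Quotient.mk (collapse N L) ⟨l₀, hLN hl₀⟩} ∧
        ∃ K : Quotient (collapse N L) × ℝ → Quotient (collapse N L),
          ∃ ξ₀ : Quotient (collapse N L),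
          ξ₀ ≠ Quotient.mk (collapse N L) ⟨l₀, hLN hl₀⟩ ∧
          ContinuousOn K (W i.succ ×ˢ Set.Icc (0 : ℝ) 1) ∧
          (∀ ξ ∈ W i.succ, ∀ s ∈ Set.Icc (0 : ℝ) 1,
            K (ξ, s) ≠ Quotient.mk (collapse N L) ⟨l₀, hLN hl₀⟩) ∧
          (∀ ξ ∈ W i.succ, K (ξ, 0) = ξ) ∧
          (∀ ξ ∈ W i.succ, K (ξ, 1) = ξ₀)) := by
  have hip : IsIndexPair φ N L := ⟨hφc, hφ0, hφadd, hN, hL, hLN, hpos, hexit⟩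
  have hpg : IsPseudoGradientFlow f α Y φ :=
    ⟨hf, hα1, hα3, hYb, hYg, hY0, hφc, hφ0, hφadd, hφode⟩
  have hps : IsPalaisSmaleOn f (closure (N \ L)) := ⟨isClosed_closure, hfb, hPS⟩
  have hVN : closure (N \ L) ⊆ N := closure_minimal sdiff_subset hN
  have hloc : ∀ y ∈ N, (∃ t ≥ (0 : ℝ), ¬ StaysIn φ (N \ L) y t) →
      ∃ t ≥ (0 : ℝ), ∀ᶠ y' in 𝓝[N] y, ¬ StaysIn φ (N \ L) y' t := by
    rintro y hy ⟨t₀, ht₀, hns⟩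
    by_contra hcon
    have hV : ∀ t ≥ (0 : ℝ), φ t y ∈ closure (N \ L) := fun t ht => by
      have hfr : ∃ᶠ y' in 𝓝[N] y, StaysIn φ (N \ L) y' t :=
        fun hev => hcon ⟨t, ht, hev⟩
      refine mem_closure_iff_frequently.2 ?_
      exact (((hip.continuous_apply t).tendsto y).mono_left nhdsWithin_le_nhds).frequently
        (hfr.mono fun y' hy' => hy' t ⟨ht, le_rfl⟩)
    have hhit : ∃ s ∈ Icc (0 : ℝ) t₀, φ s y ∈ L := by
      by_contra! hno
      exact hns ((hip.staysIn_diff_iff hy).2 hno)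
    obtain ⟨s, hs, hsL⟩ := hhit
    have hVs : ∀ t ≥ (0 : ℝ), φ t (φ s y) ∈ closure (N \ L) := fun t ht => by
      rw [← hφadd]
      exact hV _ (add_nonneg ht hs.1)
    obtain ⟨z, hzV, hz0, -, hzc⟩ := hpg.exists_rest_point hps hVs
    have hzL : z ∈ L := by
      refine closure_minimal ?_ hL hzc
      rintro _ ⟨t, ht, rfl⟩
      exact hpos _ hsL t ht (fun r hr => hVN (hVs r hr.1)) t ⟨ht, le_rfl⟩
    exact hnc z ⟨hzL, hzV⟩ hz0
  have hl₀' : ((⟨l₀, hLN hl₀⟩ : N) : E) ∈ L := hl₀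
  have hxV : ∀ i, x i ∈ closure (N \ L) ∧ fderiv ℝ f (x i) = 0 := fun i =>
    (hcrit _).2 ⟨i, rfl⟩
  have hxL : ∀ i, x i ∉ L := fun i hi => hnc _ ⟨hi, (hxV i).1⟩ (hxV i).2
  obtain ⟨W₀, hW₀o, hW₀, hH⟩ := hip.exists_deformation_to_exit hl₀' hloc
  have hball : ∀ i, x i ∈ interior (closure (N \ L)) →
      ∃ r > 0, ∃ R > 0, Metric.ball (x i) R ⊆ N \ L ∧
        ∀ y a b t, a ≤ t → t ≤ b → φ a y ∈ Metric.ball (x i) r → φ b y ∈ Metric.ball (x i) r →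
          φ t y ∈ Metric.ball (x i) R := by
    intro i hi
    have hfin : (Set.range x \ {x i}).Finite := (Set.finite_range x).sdiff
    have hnhds : interior (closure (N \ L)) ∩ Lᶜ ∩ (Set.range x \ {x i})ᶜ ∈ 𝓝 (x i) :=
      inter_mem (inter_mem (isOpen_interior.mem_nhds hi) (hL.isOpen_compl.mem_nhds (hxL i)))
        (hfin.isClosed.isOpen_compl.mem_nhds fun h => h.2 rfl)
    obtain ⟨R, hR, hRs⟩ := Metric.nhds_basis_closedBall.mem_iff.1 hnhds
    have hRV : Metric.closedBall (x i) R ⊆ closure (N \ L) := fun z hz =>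
      interior_subset (hRs hz).1.1
    obtain ⟨r, hr, hstay⟩ := hpg.exists_ball_stay hps hR hRV fun z hz hz0 => by
      by_contra hne
      obtain ⟨j, rfl⟩ := (hcrit z).1 ⟨hRV hz, hz0⟩
      exact (hRs hz).2 ⟨⟨j, rfl⟩, hne⟩
    refine ⟨r, hr, R, hR, fun z hz => ?_, hstay⟩
    have hz' := Metric.ball_subset_closedBall hz
    exact ⟨hVN (hRV hz'), (hRs hz').1.2⟩
  have hcontr : ∀ i, ∃ W : Set (Quotient (collapse N L)), IsOpen W ∧
      (x i ∈ interior (closure (N \ L)) → ∃ r > 0, ∀ y : N,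
        (∃ t ≥ (0 : ℝ), StaysIn φ (N \ L) y t ∧ φ t y ∈ Metric.ball (x i) r) →
          Quotient.mk _ y ∈ W) ∧
      W ⊆ {ξ | ξ ≠ Quotient.mk (collapse N L) ⟨l₀, hLN hl₀⟩} ∧
      ∃ K : Quotient (collapse N L) × ℝ → Quotient (collapse N L),
        ∃ ξ₀ : Quotient (collapse N L),
        ξ₀ ≠ Quotient.mk (collapse N L) ⟨l₀, hLN hl₀⟩ ∧
        ContinuousOn K (W ×ˢ Set.Icc (0 : ℝ) 1) ∧
        (∀ ξ ∈ W, ∀ s ∈ Set.Icc (0 : ℝ) 1,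
          K (ξ, s) ≠ Quotient.mk (collapse N L) ⟨l₀, hLN hl₀⟩) ∧
        (∀ ξ ∈ W, K (ξ, 0) = ξ) ∧ (∀ ξ ∈ W, K (ξ, 1) = ξ₀) := by
    intro i
    by_cases hi : x i ∈ interior (closure (N \ L))
    · obtain ⟨r, hr, R, hR, hRs, hstay⟩ := hball i hi
      obtain ⟨W, hWo, hW, hrest⟩ := hip.exists_contraction_to_ball hl₀' hR hRs hstay
      exact ⟨W, hWo, fun _ => ⟨r, hr, hW⟩, hrest⟩
    · refine ⟨∅, isOpen_empty, fun h => (hi h).elim, empty_subset _, Prod.fst,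
        Quotient.mk _ ⟨x i, hVN (hxV i).1⟩, collapse_mk_ne (hxL i) hl₀, ?_, ?_, ?_, ?_⟩ <;> simp
  choose W hWo hW hWK using hcontr
  refine ⟨Fin.cons W₀ W, ?_, ?_, ?_, ?_, ?_⟩
  · exact Fin.cases hW₀o hWo
  · refine eq_univ_of_forall fun ξ => ?_
    obtain ⟨y, rfl⟩ := Quotient.exists_rep ξ
    by_cases hy : ∃ t ≥ (0 : ℝ), ¬ StaysIn φ (N \ L) y t
    · exact mem_iUnion.2 ⟨0, hW₀ y hy⟩
    · push Not at hy
      obtain ⟨z, hzV, hz0, hrest, hzc⟩ := hpg.exists_rest_point hps (y := y)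
        fun t ht => subset_closure (hy t ht t ⟨ht, le_rfl⟩)
      have hzi := hiso z hzV fun t => by rwa [hrest]
      obtain ⟨i, rfl⟩ := (hcrit z).1 ⟨hzV, hz0⟩
      obtain ⟨r, hr, hWi⟩ := hW i hzi
      obtain ⟨_, ⟨t, ht, rfl⟩, hdist⟩ := Metric.mem_closure_iff.1 hzc r hr
      refine mem_iUnion.2 ⟨i.succ, hWi y ⟨t, ht, hy t ht, ?_⟩⟩
      rwa [Metric.mem_ball']
  · exact hW₀ _ ⟨0, le_rfl, fun H => (H 0 ⟨le_rfl, le_rfl⟩).2 (by rwa [hφ0])⟩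
  · exact hH
  · exact hWK
end

section
/- Under the Section 4 setup (pseudo-gradient flow φ for f on a Banach space E, index pair (N,L) with V = cl(N − L), f bounded on V, Palais–Smale in V, no critical points of f in L ∩ V), suppose in addition that (N,L) is a regular index pair. Then f has at least ν_H(N, L) critical points in V; that is, if f has exactly n critical points in V (n finite), then ν_H(N, L) ≤ n. -/
open scoped ENNReal

/-- The exit time map `τ₊ : N → [0,∞]` of the pair `(N, L)`:
`τ₊(x) = sup {t ≥ 0 | φ^{[0,t]}(x) ⊆ N − L}` for `x ∈ N − L` and `τ₊(x) = 0` for `x ∈ L`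
(for `x ∈ L` the set below is empty, so the supremum is `0`). -/
noncomputable def tauPlus {X : Type*} (φ : ℝ → X → X) (N L : Set X) (x : N) : ℝ≥0∞ :=
  sSup (ENNReal.ofReal '' {r : ℝ | 0 ≤ r ∧ ∀ s ∈ Set.Icc 0 r, φ s (x : X) ∈ N \ L})

section ExitTime

variable {X : Type*} {φ : ℝ → X → X} {N L : Set X}

theorem mem_diff_of_ofReal_lt_tauPlus {z : N} {t : ℝ}
    (h : ENNReal.ofReal t < tauPlus φ N L z) {s : ℝ} (hs : s ∈ Set.Icc 0 t) :
    φ s z ∈ N \ L := by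
  obtain ⟨_, ⟨r, ⟨-, hr⟩, rfl⟩, htr⟩ := lt_sSup_iff.1 h
  exact hr s ⟨hs.1, hs.2.trans (ENNReal.ofReal_lt_ofReal_iff'.1 htr).1.le⟩

theorem ofReal_le_tauPlus {z : N} {r : ℝ} (hr : 0 ≤ r)
    (h : ∀ s ∈ Set.Icc 0 r, φ s (z : X) ∈ N \ L) : ENNReal.ofReal r ≤ tauPlus φ N L z :=
  le_sSup ⟨r, ⟨hr, h⟩, rfl⟩

theorem tauPlus_eq_zero_of_mem (hφ0 : ∀ x, φ 0 x = x) {z : N} (hz : (z : X) ∈ L) :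
    tauPlus φ N L z = 0 := by
  refine le_antisymm (sSup_le ?_) bot_le
  rintro _ ⟨r, ⟨hr, h⟩, rfl⟩
  have := (h 0 ⟨le_rfl, hr⟩).2
  rw [hφ0] at this
  exact absurd hz this

/-- Before a finite exit time the orbit stays in `N \ L`. -/
theorem mem_diff_of_lt_toReal_tauPlus {z : N} {s : ℝ} (hs : 0 ≤ s)
    (hsT : s < (tauPlus φ N L z).toReal) : φ s z ∈ N \ L :=
  mem_diff_of_ofReal_lt_tauPlus
    (lt_of_lt_of_le ((ENNReal.ofReal_lt_ofReal_iff_of_nonneg hs).2 hsT) ENNReal.ofReal_toReal_le)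
    ⟨hs, le_rfl⟩

variable [TopologicalSpace X]

theorem continuousOn_image_subtype_val {Z : Type*} [TopologicalSpace Z] {g : X → Z} {U : Set N}
    (h : ContinuousOn (fun z : N => g z) U) : ContinuousOn g (Subtype.val '' U) := by
  rintro _ ⟨z, hz, rfl⟩
  rw [ContinuousWithinAt, ← Topology.IsInducing.subtypeVal.map_nhdsWithin_eq,
    Filter.tendsto_map'_iff]
  exact h z hz

/-- At a finite exit time the orbit is in the exit set `L`. -/
theorem flow_toReal_tauPlus_mem (hφc : ∀ x, Continuous fun t => φ t x)
    (hφ0 : ∀ x, φ 0 x = x) (hφadd : ∀ s t x, φ (s + t) x = φ s (φ t x))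
    (hN : IsClosed N) (hL : IsClosed L)
    (hexit : ∀ x ∈ N, ¬ (∀ t ≥ (0 : ℝ), φ t x ∈ N) →
      ∃ t ≥ (0 : ℝ), (∀ s ∈ Set.Icc 0 t, φ s x ∈ N) ∧ φ t x ∈ L)
    {z : N} (hz : tauPlus φ N L z ≠ ⊤) : φ (tauPlus φ N L z).toReal z ∈ L := by
  set T := (tauPlus φ N L z).toReal with hT
  have hT0 : 0 ≤ T := ENNReal.toReal_nonneg
  have hlt : ∀ s, 0 ≤ s → s < T → φ s z ∈ N \ L := fun s h0 h1 =>
    mem_diff_of_lt_toReal_tauPlus h0 h1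
  have hTN : φ T z ∈ N := by
    rcases hT0.eq_or_lt with h0 | h0
    · rw [← h0, hφ0]; exact z.2
    · have hcl : T ∈ closure (Set.Ico 0 T) := by
        rw [closure_Ico h0.ne]; exact ⟨hT0, le_rfl⟩
      have := map_mem_closure (t := N) (hφc z) hcl (fun s hs => (hlt s hs.1 hs.2).1)
      rwa [hN.closure_eq] at this
  by_contra hTL
  obtain ⟨δ, hδ, hδL⟩ : ∃ δ > 0, ∀ s, |s - T| < δ → φ s z ∉ L := by
    have := (hφc z).continuousAt.eventually_mem (hL.isOpen_compl.mem_nhds hTL)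
    obtain ⟨δ, hδ, h⟩ := Metric.eventually_nhds_iff.1 this
    exact ⟨δ, hδ, fun s hs => h (by rwa [Real.dist_eq])⟩
  obtain ⟨η, hη, hηN⟩ : ∃ η > 0, ∀ s, T ≤ s → s ≤ T + η → φ s z ∈ N := by
    by_cases hall : ∀ t ≥ (0 : ℝ), φ t (φ T z) ∈ N
    · refine ⟨1, one_pos, fun s hs _ => ?_⟩
      have := hall (s - T) (sub_nonneg.2 hs)
      rwa [← hφadd, sub_add_cancel] at this
    · obtain ⟨t, ht, htN, htL⟩ := hexit _ hTN hall
      refine ⟨t, lt_of_le_of_ne ht ?_, fun s hs hst => ?_⟩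
      · rintro rfl
        rw [hφ0] at htL
        exact hTL htL
      · have := htN (s - T) ⟨sub_nonneg.2 hs, by linarith⟩
        rwa [← hφadd, sub_add_cancel] at this
  have hle := ofReal_le_tauPlus (φ := φ) (L := L) (z := z) (r := T + min (δ / 2) η)
    (by positivity) (fun s hs => by
      rcases lt_or_ge s T with h | h
      · exact hlt s hs.1 h
      · have h1 := min_le_left (δ / 2) η
        have h2 := min_le_right (δ / 2) η
        refine ⟨hηN s h (by linarith [hs.2]), hδL s ?_⟩
        rw [abs_of_nonneg (by linarith)]
        linarith [hs.2])
  have hle' := (ENNReal.ofReal_le_iff_le_toReal hz).1 hle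
  have : 0 < min (δ / 2) η := by positivity
  linarith

/-- The points of `N` with finite exit time deformation retract onto `L` along the flow. -/
theorem exists_deformation_retraction_of_continuous_tauPlus
    (hφc : Continuous fun p : ℝ × X => φ p.1 p.2)
    (hφ0 : ∀ x, φ 0 x = x) (hφadd : ∀ s t x, φ (s + t) x = φ s (φ t x))
    (hN : IsClosed N) (hL : IsClosed L) (hLN : L ⊆ N)
    (hexit : ∀ x ∈ N, ¬ (∀ t ≥ (0 : ℝ), φ t x ∈ N) →
      ∃ t ≥ (0 : ℝ), (∀ s ∈ Set.Icc 0 t, φ s x ∈ N) ∧ φ t x ∈ L)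
    (hreg : Continuous (tauPlus φ N L)) :
    ∃ H : X × ℝ → X,
      ContinuousOn H ((Subtype.val '' {z : N | tauPlus φ N L z ≠ ⊤}) ×ˢ Set.Icc (0 : ℝ) 1) ∧
      (∀ z ∈ Subtype.val '' {z : N | tauPlus φ N L z ≠ ⊤}, ∀ s ∈ Set.Icc (0 : ℝ) 1,
        H (z, s) ∈ Subtype.val '' {z : N | tauPlus φ N L z ≠ ⊤}) ∧
      (∀ z ∈ Subtype.val '' {z : N | tauPlus φ N L z ≠ ⊤}, H (z, 0) = z) ∧
      (∀ z ∈ Subtype.val '' {z : N | tauPlus φ N L z ≠ ⊤}, H (z, 1) ∈ L) ∧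
      (∀ a ∈ L, ∀ s ∈ Set.Icc (0 : ℝ) 1, H (a, s) = a) := by
  classical
  have hφct : ∀ x, Continuous fun t => φ t x := fun x => hφc.comp (Continuous.prodMk_left x)
  let τ : X → ℝ := fun z => if h : z ∈ N then (tauPlus φ N L ⟨z, h⟩).toReal else 0
  have hτ : ∀ z : N, τ z = (tauPlus φ N L z).toReal := fun z => by simp [τ]
  have hτc : ContinuousOn τ (Subtype.val '' {z : N | tauPlus φ N L z ≠ ⊤}) := by
    refine continuousOn_image_subtype_val ?_
    refine ContinuousOn.congr (f := fun z : N => (tauPlus φ N L z).toReal) ?_ fun z _ => hτ z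
    exact ENNReal.continuousOn_toReal.comp hreg.continuousOn fun z hz => hz
  refine ⟨fun p => φ (p.2 * τ p.1) p.1, ?_, ?_, ?_, ?_, ?_⟩
  · refine hφc.comp_continuousOn (ContinuousOn.prodMk ?_ continuousOn_fst)
    exact continuousOn_snd.mul (hτc.comp continuousOn_fst fun p hp => hp.1)
  · rintro _ ⟨z, hz, rfl⟩ s hs
    simp only [hτ]
    set T := (tauPlus φ N L z).toReal with hT
    have hT0 : 0 ≤ T := ENNReal.toReal_nonneg
    have hs0 : 0 ≤ s * T := mul_nonneg hs.1 hT0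
    have hsT : s * T ≤ T := mul_le_of_le_one_left hT0 hs.2
    rcases hsT.lt_or_eq with h | h
    · refine ⟨⟨_, (mem_diff_of_lt_toReal_tauPlus hs0 h).1⟩, ?_, rfl⟩
      refine ne_top_of_le_ne_top hz (sSup_le ?_)
      rintro _ ⟨r, ⟨hr, hrN⟩, rfl⟩
      refine le_trans (ENNReal.ofReal_le_ofReal (le_add_of_nonneg_right hs0))
        (ofReal_le_tauPlus (r := r + s * T) (by positivity) fun u hu => ?_)
      rcases lt_or_ge u (s * T) with h' | h'
      · exact mem_diff_of_lt_toReal_tauPlus hu.1 (h'.trans h)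
      · have := hrN (u - s * T) ⟨sub_nonneg.2 h', by linarith [hu.2]⟩
        rwa [← hφadd, sub_add_cancel] at this
    · have hmem := flow_toReal_tauPlus_mem hφct hφ0 hφadd hN hL hexit hz
      rw [← hT] at hmem
      rw [h]
      refine ⟨⟨_, hLN hmem⟩, ?_, rfl⟩
      simp [tauPlus_eq_zero_of_mem (N := N) (z := ⟨_, hLN hmem⟩) hφ0 hmem]
  · intro z _
    simp [hφ0]
  · rintro _ ⟨z, hz, rfl⟩
    simp only [hτ, one_mul]
    exact flow_toReal_tauPlus_mem hφct hφ0 hφadd hN hL hexit hz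
  · intro a ha s _
    have : τ a = 0 := by
      rw [hτ ⟨a, hLN ha⟩, tauPlus_eq_zero_of_mem (z := ⟨a, hLN ha⟩) hφ0 ha, ENNReal.toReal_zero]
    simp [this, hφ0]

end ExitTime

section Landing

variable {E : Type*} [NormedAddCommGroup E] {φ : ℝ → E → E} {N L : Set E}

/-- Points of `N` whose orbit visits the open ball of radius `r` about `p` before exiting. -/
def landingSet (φ : ℝ → E → E) (N L : Set E) (p : E) (r : ℝ) : Set N :=
  {z | ∃ t : ℝ, 0 ≤ t ∧ ENNReal.ofReal t < tauPlus φ N L z ∧ φ t z ∈ Metric.ball p r}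

theorem eventually_landing (hφc : Continuous fun p : ℝ × E => φ p.1 p.2)
    (hreg : Continuous (tauPlus φ N L)) {p : E} {r t : ℝ} {z : N}
    (h1 : ENNReal.ofReal t < tauPlus φ N L z) (h2 : φ t z ∈ Metric.ball p r) :
    ∀ᶠ y in nhds z, ENNReal.ofReal t < tauPlus φ N L y ∧ φ t y ∈ Metric.ball p r := by
  have hc : Continuous fun y : N => φ t (y : E) :=
    hφc.comp (continuous_const.prodMk continuous_subtype_val)
  exact (hreg.continuousAt.eventually (lt_mem_nhds h1)).and
    (hc.continuousAt.eventually_mem (Metric.isOpen_ball.mem_nhds h2))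

theorem isOpen_landingSet (hφc : Continuous fun p : ℝ × E => φ p.1 p.2)
    (hreg : Continuous (tauPlus φ N L)) (p : E) (r : ℝ) : IsOpen (landingSet φ N L p r) := by
  rw [isOpen_iff_mem_nhds]
  rintro z ⟨t, ht, h1, h2⟩
  filter_upwards [eventually_landing hφc hreg h1 h2] with y hy
  exact ⟨t, ht, hy⟩

theorem landingSet_subset (hφ0 : ∀ x, φ 0 x = x) (p : E) (r : ℝ) :
    Subtype.val '' landingSet φ N L p r ⊆ N \ L := by
  rintro _ ⟨z, ⟨t, ht, h1, -⟩, rfl⟩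
  simpa [hφ0] using mem_diff_of_ofReal_lt_tauPlus h1 (s := 0) ⟨le_rfl, ht⟩

/-- If no orbit returns to the small ball after leaving the big one, the points landing in the
small ball can be contracted in `N \ L`. -/
theorem landingSet_contractible [NormedSpace ℝ E]
    (hφc : Continuous fun p : ℝ × E => φ p.1 p.2) (hφ0 : ∀ x, φ 0 x = x)
    (hreg : Continuous (tauPlus φ N L)) {p : E} {r R : ℝ} (hR : 0 < R)
    (hball : Metric.ball p R ⊆ N \ L)
    (hret : ∀ z a b c, a ≤ b → b ≤ c → φ a z ∈ Metric.ball p r → φ c z ∈ Metric.ball p r →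
      φ b z ∈ Metric.ball p R) :
    ∃ K : E × ℝ → E, ∃ z₀ ∈ N \ L,
      ContinuousOn K ((Subtype.val '' landingSet φ N L p r) ×ˢ Set.Icc (0 : ℝ) 1) ∧
      (∀ z ∈ Subtype.val '' landingSet φ N L p r, ∀ s ∈ Set.Icc (0 : ℝ) 1, K (z, s) ∈ N \ L) ∧
      (∀ z ∈ Subtype.val '' landingSet φ N L p r, K (z, 0) = z) ∧
      (∀ z ∈ Subtype.val '' landingSet φ N L p r, K (z, 1) = z₀) := by
  classical
  let T : N → Set ℝ := fun z =>
    {t | 0 ≤ t ∧ ENNReal.ofReal t < tauPlus φ N L z ∧ φ t z ∈ Metric.ball p r}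
  let S : landingSet φ N L p r → Set ℝ := fun z =>
    {t | ∃ a ∈ T z, ∃ c ∈ T z, a ≤ t ∧ t ≤ c}
  obtain ⟨g, hg⟩ : ∃ g : C(landingSet φ N L p r, ℝ), ∀ z, g z ∈ S z := by
    refine exists_continuous_forall_mem_convex_of_local_const (fun z => ?_) fun z => ?_
    · refine Set.OrdConnected.convex ⟨?_⟩
      rintro u ⟨a, ha, _, _, hau, _⟩ v ⟨_, _, c, hc, _, hvc⟩ w hw
      exact ⟨a, ha, c, hc, hau.trans hw.1, hw.2.trans hvc⟩
    · obtain ⟨t, ht, h1, h2⟩ := z.2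
      refine ⟨t, ?_⟩
      filter_upwards [continuous_subtype_val.continuousAt.eventually
        (eventually_landing hφc hreg h1 h2)] with y hy
      exact ⟨t, ⟨ht, hy⟩, t, ⟨ht, hy⟩, le_rfl, le_rfl⟩
  let τ : E → ℝ := fun z => if h : ∃ h : z ∈ N, (⟨z, h⟩ : N) ∈ landingSet φ N L p r
    then g ⟨⟨z, h.1⟩, h.2⟩ else 0
  have hτ : ∀ z : landingSet φ N L p r, τ (z : N) = g z := fun z => by
    have : ∃ h : ((z : N) : E) ∈ N, (⟨z, h⟩ : N) ∈ landingSet φ N L p r := ⟨z.1.2, z.2⟩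
    simp only [τ, dif_pos this]
  have hτc : ContinuousOn τ (Subtype.val '' landingSet φ N L p r) := by
    refine continuousOn_image_subtype_val ?_
    rw [continuousOn_iff_continuous_domRestrict]
    exact g.continuous.congr fun z => (hτ z).symm
  have hτ0 : ∀ z : landingSet φ N L p r, 0 ≤ g z := fun z => by
    obtain ⟨a, ha, -, -, h, -⟩ := hg z
    exact ha.1.trans h
  have hstay : ∀ z : landingSet φ N L p r, ∀ s ∈ Set.Icc 0 (g z), φ s (z : N) ∈ N \ L := by
    intro z s hs
    obtain ⟨-, -, c, hc, -, h⟩ := hg z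
    exact mem_diff_of_ofReal_lt_tauPlus hc.2.1 ⟨hs.1, hs.2.trans h⟩
  have hland : ∀ z : landingSet φ N L p r, φ (g z) (z : N) ∈ Metric.ball p R := by
    intro z
    obtain ⟨a, ha, c, hc, h, h'⟩ := hg z
    exact hret _ _ _ _ h h' ha.2.2 hc.2.2
  let P : E × ℝ → E := fun q => φ (min (2 * q.2) 1 * τ q.1) q.1
  refine ⟨fun q => P q + max (2 * q.2 - 1) 0 • (p - P q), p, hball (Metric.mem_ball_self hR),
    ?_, ?_, ?_, ?_⟩
  · have hP : ContinuousOn P ((Subtype.val '' landingSet φ N L p r) ×ˢ Set.Icc (0 : ℝ) 1) := by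
      refine hφc.comp_continuousOn (ContinuousOn.prodMk ?_ continuousOn_fst)
      refine ContinuousOn.mul (by fun_prop) (hτc.comp continuousOn_fst fun q hq => hq.1)
    exact hP.add (ContinuousOn.smul (by fun_prop) (continuousOn_const.sub hP))
  · rintro _ ⟨z, hz, rfl⟩ s hs
    have hz' := hτ ⟨z, hz⟩
    have h0 := hτ0 ⟨z, hz⟩
    simp only [P]
    simp only at hz'
    rw [hz']
    rcases le_total (2 * s) 1 with h | h
    · rw [min_eq_left h, max_eq_right (by linarith), zero_smul, add_zero]
      refine hstay ⟨z, hz⟩ _ ⟨mul_nonneg (by linarith [hs.1]) h0, mul_le_of_le_one_left h0 h⟩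
    · rw [min_eq_right h, max_eq_left (by linarith), one_mul]
      exact hball ((convex_ball p R).add_smul_sub_mem (hland ⟨z, hz⟩) (Metric.mem_ball_self hR)
        ⟨by linarith, by linarith [hs.2]⟩)
  · intro z _
    simp [P, hφ0]
  · intro z _
    norm_num

end Landing

section Growth

variable {E : Type*} [NormedAddCommGroup E] [NormedSpace ℝ E] {f : E → ℝ} {Y : E → E}
  {φ : ℝ → E → E}

/-- Palais–Smale gives a uniform lower bound for the derivative on closed sets without critical
points. -/
theorem exists_pos_le_norm_fderiv_of_palaisSmale (hf : ContDiff ℝ 1 f) {V S : Set E}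
    (hfb : ∃ C, ∀ x ∈ V, |f x| ≤ C)
    (hPS : ∀ u : ℕ → E, (∀ n, u n ∈ V) → (∃ C, ∀ n, |f (u n)| ≤ C) →
      Filter.Tendsto (fun n => ‖fderiv ℝ f (u n)‖) Filter.atTop (nhds 0) →
      ∃ x : E, ∃ σ : ℕ → ℕ, StrictMono σ ∧ Filter.Tendsto (u ∘ σ) Filter.atTop (nhds x))
    (hS : IsClosed S) (hSV : S ⊆ V) (hcrit : ∀ z ∈ S, fderiv ℝ f z ≠ 0) :
    ∃ ε > 0, ∀ z ∈ S, ε ≤ ‖fderiv ℝ f z‖ := by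
  by_contra! h
  choose u huS hu using fun n : ℕ => h (1 / ((n : ℝ) + 1)) Nat.one_div_pos_of_nat
  have hlim : Filter.Tendsto (fun n => ‖fderiv ℝ f (u n)‖) Filter.atTop (nhds 0) :=
    squeeze_zero (fun _ => norm_nonneg _) (fun n => (hu n).le) tendsto_one_div_add_atTop_nhds_zero_nat
  obtain ⟨C, hC⟩ := hfb
  obtain ⟨z, σ, hσ, hz⟩ := hPS u (fun n => hSV (huS n)) ⟨C, fun n => hC _ (hSV (huS n))⟩ hlim
  refine hcrit z (hS.mem_of_tendsto hz (Filter.Eventually.of_forall fun n => huS _)) ?_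
  have h1 := ((hf.continuous_fderiv one_ne_zero).norm.tendsto z).comp hz
  exact norm_eq_zero.1 (tendsto_nhds_unique h1 (hlim.comp hσ.tendsto_atTop))

theorem mul_sub_le_image_flow_sub (hf : ContDiff ℝ 1 f)
    (hφode : ∀ x t, HasDerivAt (fun s : ℝ => φ s x) (Y (φ t x)) t) {z : E} {m a b : ℝ}
    (hab : a ≤ b) (hm : ∀ t ∈ Set.Icc a b, m ≤ fderiv ℝ f (φ t z) (Y (φ t z))) :
    m * (b - a) ≤ f (φ b z) - f (φ a z) := by
  have hd : ∀ t, HasDerivAt (fun s => f (φ s z)) (fderiv ℝ f (φ t z) (Y (φ t z))) t := fun t =>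
    ((hf.differentiable one_ne_zero) (φ t z)).hasFDerivAt.comp_hasDerivAt t (hφode z t)
  exact (convex_Icc a b).mul_sub_le_image_sub_of_le_deriv
    (fun t _ => (hd t).continuousAt.continuousWithinAt)
    (fun t _ => (hd t).differentiableAt.differentiableWithinAt)
    (fun t ht => by rw [(hd t).deriv]; exact hm t (interior_subset ht))
    a ⟨le_rfl, hab⟩ b ⟨hab, le_rfl⟩ hab

/-- A zero of `Y` whose value does not increase strictly along its forward orbit is a rest point. -/
theorem flow_eq_self_of_image_flow_one_le (hf : ContDiff ℝ 1 f) (hφ0 : ∀ x, φ 0 x = x)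
    (hφadd : ∀ s t x, φ (s + t) x = φ s (φ t x))
    (hφode : ∀ x t, HasDerivAt (fun s : ℝ => φ s x) (Y (φ t x)) t)
    (hmono : ∀ x, 0 ≤ fderiv ℝ f x (Y x)) (hzero : ∀ x, fderiv ℝ f x (Y x) = 0 → Y x = 0) {p : E}
    (hp : f (φ 1 p) ≤ f p) (t : ℝ) : φ t p = p := by
  have hle : ∀ a b, a ≤ b → f (φ a p) ≤ f (φ b p) := fun a b hab => by
    have := mul_sub_le_image_flow_sub hf hφode (z := p) hab fun s _ => hmono (φ s p)
    linarith
  have hconst : ∀ s ∈ Set.Icc (0 : ℝ) 1, f (φ s p) = f p := fun s hs =>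
    le_antisymm ((hle s 1 hs.2).trans hp) (by simpa [hφ0] using hle 0 s hs.1)
  have hY : ∀ s ∈ Set.Ioo (0 : ℝ) 1, Y (φ s p) = 0 := fun s hs => by
    have hd := ((hf.differentiable one_ne_zero) (φ s p)).hasFDerivAt.comp_hasDerivAt s (hφode p s)
    refine hzero _ (hd.unique ((hasDerivAt_const s (f p)).congr_of_eventuallyEq ?_))
    filter_upwards [Icc_mem_nhds hs.1 hs.2] with u hu using hconst u hu
  have hfix : ∀ s ∈ Set.Icc (0 : ℝ) 1, φ s p = p := fun s hs => by
    have h := constant_of_has_deriv_right_zero (f := fun s => φ s p) (a := 1 / 4) (b := 3 / 4)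
      (fun u _ => (hφode p u).continuousAt.continuousWithinAt)
      fun u hu => by
        have := (hφode p u).hasDerivWithinAt (s := Set.Ici u)
        rwa [hY u ⟨by linarith [hu.1], by linarith [hu.2]⟩] at this
    have key : ∀ v ∈ Set.Icc (0 : ℝ) (1 / 2), φ v p = p := fun v hv => by
      have h1 : φ (v + 1 / 4) p = φ (1 / 4) p := h _ ⟨by linarith [hv.1], by linarith [hv.2]⟩
      have h2 := congrArg (φ (-(1 / 4))) h1
      rw [← hφadd, ← hφadd] at h2
      simpa [hφ0] using h2
    have h1 := key (s / 2) ⟨by linarith [hs.1], by linarith [hs.2]⟩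
    rw [← add_halves s, hφadd, h1, h1]
  have hnat : ∀ k : ℕ, φ k p = p := fun k => by
    induction k with
    | zero => simpa using hφ0 p
    | succ k ih => rw [Nat.cast_succ, hφadd, hfix 1 ⟨zero_le_one, le_rfl⟩, ih]
  have hnonneg : ∀ s, 0 ≤ s → φ s p = p := fun s hs => by
    rw [← Int.fract_add_floor s, hφadd]
    obtain ⟨k, hk⟩ := Int.eq_ofNat_of_zero_le (Int.floor_nonneg.2 hs)
    rw [hk, Int.cast_natCast, hnat, hfix _ ⟨Int.fract_nonneg _, (Int.fract_lt_one _).le⟩]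
  rcases le_total 0 t with ht | ht
  · exact hnonneg t ht
  · have := hφadd t (-t) p
    rwa [add_neg_cancel, hφ0, hnonneg (-t) (by linarith), eq_comm] at this

/-- Near a point surrounded by an annulus on which `f` increases at a definite rate along the flow,
orbits leaving a given ball never return to a smaller ball. -/
theorem exists_ball_no_return (hf : ContDiff ℝ 1 f)
    (hφode : ∀ x t, HasDerivAt (fun s : ℝ => φ s x) (Y (φ t x)) t)
    (hYb : ∃ C, ∀ x, ‖Y x‖ ≤ C) (hmono : ∀ x, 0 ≤ fderiv ℝ f x (Y x)) {p : E} {R m : ℝ}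
    (hR : 0 < R) (hm : 0 < m)
    (hann : ∀ x, R / 2 ≤ dist x p → dist x p ≤ R → m ≤ fderiv ℝ f x (Y x)) :
    ∃ r > 0, ∀ z a b c, a ≤ b → b ≤ c → φ a z ∈ Metric.ball p r → φ c z ∈ Metric.ball p r →
      φ b z ∈ Metric.ball p R := by
  obtain ⟨C₀, hC₀⟩ := hYb
  obtain ⟨C, hC, hYC⟩ : ∃ C > 0, ∀ x, ‖Y x‖ ≤ C :=
    ⟨max C₀ 1, by positivity, fun x => (hC₀ x).trans (le_max_left _ _)⟩
  set d := R / (4 * C) with hd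
  have hd0 : 0 < d := by positivity
  have hCd : C * d = R / 4 := by rw [hd]; field_simp
  obtain ⟨r₀, hr₀, hfr⟩ := Metric.continuousAt_iff.1 (hf.continuous.continuousAt (x := p))
    (m * d / 2) (by positivity)
  refine ⟨min r₀ (R / 2), by positivity, fun z a b c hab hbc ha hc => ?_⟩
  by_contra hb
  have hlip : ∀ s t, dist (φ s z) (φ t z) ≤ C * |s - t| := fun s t => by
    rw [dist_eq_norm, ← Real.norm_eq_abs]
    exact convex_univ.norm_image_sub_le_of_norm_hasDerivWithin_le
      (fun t _ => (hφode z t).hasDerivWithinAt) (fun t _ => hYC _) trivial trivial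
  have hga : dist (φ a z) p < R / 2 := (Metric.mem_ball.1 ha).trans_le (min_le_right _ _)
  have hgb : R ≤ dist (φ b z) p := not_lt.1 fun h => hb (Metric.mem_ball.2 h)
  obtain ⟨t, ⟨hat, htb⟩, ht⟩ : ∃ t ∈ Set.Icc a b, dist (φ t z) p = 3 * R / 4 := by
    have hcont : ContinuousOn (fun t => dist (φ t z) p) (Set.Icc a b) := fun t _ =>
      ContinuousAt.continuousWithinAt ((hφode z t).continuousAt.dist continuousAt_const)
    exact intermediate_value_Icc hab hcont ⟨by linarith, by linarith⟩
  have hnear : ∀ s ∈ Set.Icc (t - d) t,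
      R / 2 ≤ dist (φ s z) p ∧ dist (φ s z) p ≤ R := fun s hs => by
    have h1 := hlip s t
    have h2 : C * |s - t| ≤ R / 4 := by
      rw [← hCd]
      gcongr
      rw [abs_le]
      constructor <;> linarith [hs.1, hs.2]
    have h3 := dist_triangle (φ s z) (φ t z) p
    have h4 := dist_triangle_left (φ t z) p (φ s z)
    constructor <;> linarith
  have had : a ≤ t - d := by
    by_contra! h
    linarith [(hnear a ⟨h.le, hat⟩).1]
  have h1 := mul_sub_le_image_flow_sub hf hφode (z := z) had fun s _ => hmono (φ s z)
  have h2 := mul_sub_le_image_flow_sub hf hφode (z := z) (sub_le_self t hd0.le)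
    fun s hs => hann _ (hnear s hs).1 (hnear s hs).2
  have h3 := mul_sub_le_image_flow_sub hf hφode (z := z) (htb.trans hbc)
    fun s _ => hmono (φ s z)
  have h4 := hfr ((Metric.mem_ball.1 ha).trans_le (min_le_left _ _))
  have h5 := hfr ((Metric.mem_ball.1 hc).trans_le (min_le_left _ _))
  rw [Real.dist_eq, abs_lt] at h4 h5
  have h6 : m * (t - (t - d)) = m * d := by ring
  linarith [h4.1, h5.2]

end Growth

theorem stmt19
    {E : Type*} [NormedAddCommGroup E] [NormedSpace ℝ E] [CompleteSpace E]
    (f : E → ℝ) (hf : ContDiff ℝ 1 f)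
    -- α : [0,∞) → [0,∞) is strictly increasing and continuous with α(0) = 0
    (α : ℝ → ℝ) (hα1 : StrictMonoOn α (Set.Ici 0))
    (hα2 : ContinuousOn α (Set.Ici 0)) (hα3 : α 0 = 0)
    (hα4 : ∀ r : ℝ, 0 ≤ r → 0 ≤ α r)
    -- Y is a pseudo-gradient vector field for f
    (Y : E → E) (hYb : ∃ C, ∀ x, ‖Y x‖ ≤ C)
    (hYg : ∀ x, α ‖fderiv ℝ f x‖ ≤ fderiv ℝ f x (Y x))
    (hY0 : ∀ x, fderiv ℝ f x = 0 → Y x = 0)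
    -- φ is the flow of Y
    (φ : ℝ → E → E)
    (hφc : Continuous fun p : ℝ × E => φ p.1 p.2)
    (hφ0 : ∀ x, φ 0 x = x)
    (hφadd : ∀ s t x, φ (s + t) x = φ s (φ t x))
    (hφode : ∀ x t, HasDerivAt (fun s : ℝ => φ s x) (Y (φ t x)) t)
    -- (N, L) is an index pair: closed, (i), (ii), cl(N − L) isolating
    (N L : Set E) (hN : IsClosed N) (hL : IsClosed L) (hLN : L ⊆ N)
    (hpos : ∀ x ∈ L, ∀ t ≥ (0 : ℝ), (∀ s ∈ Set.Icc 0 t, φ s x ∈ N) →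
      ∀ s ∈ Set.Icc 0 t, φ s x ∈ L)
    (hexit : ∀ x ∈ N, ¬ (∀ t ≥ (0 : ℝ), φ t x ∈ N) →
      ∃ t ≥ (0 : ℝ), (∀ s ∈ Set.Icc 0 t, φ s x ∈ N) ∧ φ t x ∈ L)
    (hiso : ∀ x ∈ closure (N \ L), (∀ t : ℝ, φ t x ∈ closure (N \ L)) →
      x ∈ interior (closure (N \ L)))
    -- f is bounded on V = cl(N − L)
    (hfb : ∃ C, ∀ x ∈ closure (N \ L), |f x| ≤ C)
    -- f satisfies the Palais–Smale condition in V
    (hPS : ∀ u : ℕ → E, (∀ n, u n ∈ closure (N \ L)) →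
      (∃ C, ∀ n, |f (u n)| ≤ C) →
      Filter.Tendsto (fun n => ‖fderiv ℝ f (u n)‖) Filter.atTop (nhds 0) →
      ∃ x : E, ∃ σ : ℕ → ℕ, StrictMono σ ∧
        Filter.Tendsto (u ∘ σ) Filter.atTop (nhds x))
    -- f has no critical points in L ∩ V
    (hnc : ∀ x ∈ L ∩ closure (N \ L), fderiv ℝ f x ≠ 0)
    -- (N, L) is a regular index pair
    (hreg : Continuous (tauPlus φ N L))
    (n : ℕ)
    -- x 1, …, x n are exactly the critical points of f in V
    (x : Fin n → E) (hxinj : Function.Injective x)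
    (hcrit : ∀ z : E, (z ∈ closure (N \ L) ∧ fderiv ℝ f z = 0) ↔ ∃ i, x i = z) :
    -- ν_H(N, L) ≤ n : a relatively open cover W 0, …, W n of N such that L is a
    -- deformation retract of W 0 and each W i (i ≥ 1) lies in N − L and is
    -- contractible in N − L
    ∃ W : Fin (n + 1) → Set E,
      (∀ i, ∃ O : Set E, IsOpen O ∧ W i = O ∩ N) ∧ N ⊆ (⋃ i, W i) ∧
      L ⊆ W 0 ∧
      (∃ H : E × ℝ → E,
        ContinuousOn H (W 0 ×ˢ Set.Icc (0 : ℝ) 1) ∧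
        (∀ z ∈ W 0, ∀ s ∈ Set.Icc (0 : ℝ) 1, H (z, s) ∈ W 0) ∧
        (∀ z ∈ W 0, H (z, 0) = z) ∧
        (∀ z ∈ W 0, H (z, 1) ∈ L) ∧
        (∀ a ∈ L, ∀ s ∈ Set.Icc (0 : ℝ) 1, H (a, s) = a)) ∧
      (∀ i : Fin n,
        W i.succ ⊆ N \ L ∧
        ∃ K : E × ℝ → E, ∃ z₀ ∈ N \ L,
          ContinuousOn K (W i.succ ×ˢ Set.Icc (0 : ℝ) 1) ∧
          (∀ z ∈ W i.succ, ∀ s ∈ Set.Icc (0 : ℝ) 1, K (z, s) ∈ N \ L) ∧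
          (∀ z ∈ W i.succ, K (z, 0) = z) ∧
          (∀ z ∈ W i.succ, K (z, 1) = z₀)) := by
  have hVN : closure (N \ L) ⊆ N := closure_minimal Set.sdiff_subset hN
  have hcV : ∀ i, x i ∈ closure (N \ L) ∧ fderiv ℝ f (x i) = 0 := fun i => (hcrit _).2 ⟨i, rfl⟩
  have hmono : ∀ z, 0 ≤ fderiv ℝ f z (Y z) := fun z =>
    (hα4 _ (norm_nonneg _)).trans (hYg z)
  have hαle : ∀ ε > 0, ∀ z, ε ≤ ‖fderiv ℝ f z‖ → α ε ≤ fderiv ℝ f z (Y z) := fun ε hε z hz =>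
    (hα1.monotoneOn hε.le (norm_nonneg _) hz).trans (hYg z)
  have hαpos : ∀ ε > 0, 0 < α ε := fun ε hε => by
    simpa [hα3] using hα1 (Set.mem_Ici.2 le_rfl) (Set.mem_Ici.2 hε.le) hε
  have hzero : ∀ z, fderiv ℝ f z (Y z) = 0 → Y z = 0 := fun z hz => hY0 z <| by
    by_contra hne
    exact ((hαpos _ (norm_pos_iff.2 hne)).trans_le (hYg z)).ne' hz
  have hball : ∀ i, (∀ t, φ t (x i) = x i) → ∃ R > 0, Metric.ball (x i) R ⊆ N \ L ∧ ∃ r > 0, ∀ z a b c, a ≤ b → b ≤ c →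
      φ a z ∈ Metric.ball (x i) r → φ c z ∈ Metric.ball (x i) r →
      φ b z ∈ Metric.ball (x i) R := by
    intro i hrest
    have hint : x i ∈ interior (closure (N \ L)) :=
      hiso _ (hcV i).1 fun t => by rw [hrest]; exact (hcV i).1
    have hxL : x i ∉ L := fun h => hnc _ ⟨h, (hcV i).1⟩ (hcV i).2
    have hothers : ((Set.range x) \ {x i})ᶜ ∈ nhds (x i) :=
      ((Set.finite_range x).sdiff.isClosed.isOpen_compl).mem_nhds (by simp)
    obtain ⟨R, hR, hsub⟩ := Metric.nhds_basis_closedBall.mem_iff.1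
      (Filter.inter_mem (Filter.inter_mem (isOpen_interior.mem_nhds hint)
        (hL.isOpen_compl.mem_nhds hxL)) hothers)
    have hsubV : Metric.closedBall (x i) R ⊆ closure (N \ L) := fun z hz =>
      interior_subset (hsub hz).1.1
    refine ⟨R, hR, fun z hz => ?_, ?_⟩
    · have hz' := Metric.ball_subset_closedBall hz
      exact ⟨hVN (hsubV hz'), (hsub hz').1.2⟩
    · obtain ⟨ε, hε, hεS⟩ := exists_pos_le_norm_fderiv_of_palaisSmale hf hfb hPS
        (S := Metric.closedBall (x i) R \ Metric.ball (x i) (R / 2))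
        (Metric.isClosed_closedBall.sdiff Metric.isOpen_ball)
        (fun z hz => hsubV hz.1) fun z hz h0 => by
          obtain ⟨j, rfl⟩ := (hcrit z).1 ⟨hsubV hz.1, h0⟩
          have hne : x j ≠ x i := fun h => hz.2 (by rw [h]; exact Metric.mem_ball_self (by positivity))
          exact (hsub hz.1).2 ⟨⟨j, rfl⟩, hne⟩
      exact exists_ball_no_return hf hφode hYb hmono hR (hαpos ε hε) fun z h1 h2 =>
        hαle ε hε z (hεS z ⟨Metric.mem_closedBall.2 h2, fun h => (Metric.mem_ball.1 h).not_ge h1⟩)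
  -- a critical point that is not a rest point needs no open set: `f` gains a definite amount
  -- whenever an orbit passes near it
  have hlocal : ∀ i, ∃ r > 0, ∃ η > 0, ∃ U : Set N, IsOpen U ∧ Subtype.val '' U ⊆ N \ L ∧
      (∃ K : E × ℝ → E, ∃ z₀ ∈ N \ L,
        ContinuousOn K ((Subtype.val '' U) ×ˢ Set.Icc (0 : ℝ) 1) ∧
        (∀ z ∈ Subtype.val '' U, ∀ s ∈ Set.Icc (0 : ℝ) 1, K (z, s) ∈ N \ L) ∧
        (∀ z ∈ Subtype.val '' U, K (z, 0) = z) ∧ (∀ z ∈ Subtype.val '' U, K (z, 1) = z₀)) ∧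
      ∀ z : N, tauPlus φ N L z = ⊤ → ∀ t ≥ 0, φ t z ∈ Metric.ball (x i) r →
        z ∈ U ∨ η ≤ f (φ (t + 1) z) - f (φ t z) := by
    intro i
    by_cases hp : f (φ 1 (x i)) ≤ f (x i)
    · obtain ⟨R, hR, hRN, r, hr, hret⟩ := hball i
        (flow_eq_self_of_image_flow_one_le hf hφ0 hφadd hφode hmono hzero hp)
      exact ⟨r, hr, 1, one_pos, landingSet φ N L (x i) r, isOpen_landingSet hφc hreg _ _,
        landingSet_subset hφ0 _ _, landingSet_contractible hφc hφ0 hreg hR hRN hret,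
        fun z hz t ht htz => Or.inl ⟨t, ht, by simp [hz], htz⟩⟩
    · obtain ⟨η, hη, hηp⟩ := exists_between (sub_pos.2 (not_le.1 hp))
      have hcont : Continuous fun y => f (φ 1 y) - f y :=
        (hf.continuous.comp (hφc.comp (Continuous.prodMk_right 1))).sub hf.continuous
      obtain ⟨r, hr, hsub⟩ := Metric.eventually_nhds_iff_ball.1
        (hcont.continuousAt.eventually (lt_mem_nhds hηp))
      refine ⟨r, hr, η, hη, ∅, isOpen_empty, by simp, ⟨Prod.fst, x i,
        ⟨hVN (hcV i).1, fun h => hnc _ ⟨h, (hcV i).1⟩ (hcV i).2⟩, by simp⟩,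
        fun z _ t _ htz => Or.inr ?_⟩
      rw [add_comm, hφadd]
      exact (hsub _ htz).le
  choose r hr η hη U hUo hUN hUK hU using hlocal
  have hcover : ∀ z : N, tauPlus φ N L z = ⊤ → ∃ i, z ∈ U i := by
    intro z hz
    by_contra! hno
    have hV : ∀ t, 0 ≤ t → φ t z ∈ closure (N \ L) := fun t ht =>
      subset_closure (mem_diff_of_ofReal_lt_tauPlus (t := t) (by simp [hz]) ⟨ht, le_rfl⟩)
    obtain ⟨ε, hε, hεS⟩ := exists_pos_le_norm_fderiv_of_palaisSmale hf hfb hPS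
      (S := closure (N \ L) \ ⋃ i, Metric.ball (x i) (r i))
      (isClosed_closure.sdiff (isOpen_iUnion fun i => Metric.isOpen_ball))
      Set.sdiff_subset fun y hy h0 => by
        obtain ⟨j, rfl⟩ := (hcrit y).1 ⟨hy.1, h0⟩
        exact hy.2 (Set.mem_iUnion.2 ⟨j, Metric.mem_ball_self (hr j)⟩)
    obtain ⟨C, hC⟩ := hfb
    obtain ⟨m, ⟨hmη, hmε⟩, hm⟩ : ∃ m, ((∀ i, m < η i) ∧ m < α ε) ∧ 0 < m :=
      (((Filter.eventually_all.2 fun i => nhdsWithin_le_nhds (gt_mem_nhds (hη i))).and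
        (nhdsWithin_le_nhds (gt_mem_nhds (hαpos ε hε)))).and
        (self_mem_nhdsWithin (s := Set.Ioi (0 : ℝ)))).exists
    have hle : ∀ a b, a ≤ b → f (φ a z) ≤ f (φ b z) := fun a b hab => by
      have := mul_sub_le_image_flow_sub hf hφode (z := (z : E)) hab fun s _ => hmono (φ s z)
      linarith
    have hstep : ∀ t, 0 ≤ t → m ≤ f (φ (t + 2) z) - f (φ t z) := fun t ht => by
      by_cases h : ∃ s ∈ Set.Icc t (t + 1), ∃ i, φ s z ∈ Metric.ball (x i) (r i)
      · obtain ⟨s, hs, i, hi⟩ := h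
        have h1 := (hU i z hz s (ht.trans hs.1) hi).resolve_left (hno i)
        linarith [hle t s hs.1, hle (s + 1) (t + 2) (by linarith [hs.2]), hmη i]
      · push Not at h
        have hgrow := mul_sub_le_image_flow_sub hf hφode (z := (z : E)) (a := t) (b := t + 1)
          (by linarith) fun s hs => hαle ε hε _ (hεS _ ⟨hV s (ht.trans hs.1), fun h' => by
            obtain ⟨i, hi⟩ := Set.mem_iUnion.1 h'
            exact h s hs i hi⟩)
        rw [add_sub_cancel_left, mul_one] at hgrow
        linarith [hle (t + 1) (t + 2) (by linarith)]
    have hsum : ∀ k : ℕ, k * m ≤ f (φ (2 * k) z) - f (φ 0 z) := fun k => by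
      induction k with
      | zero => simp
      | succ k ih =>
        have := hstep (2 * k) (by positivity)
        push_cast
        rw [show (2 : ℝ) * (k + 1) = 2 * k + 2 by ring]
        linarith
    obtain ⟨k, hk⟩ := exists_nat_gt (2 * C / m)
    rw [div_lt_iff₀ hm] at hk
    have h1 := abs_le.1 (hC _ (hV (2 * k) (by positivity)))
    have h2 := abs_le.1 (hC _ (hV 0 le_rfl))
    linarith [h1.2, h2.1, hsum k]
  have hopen : ∀ U : Set N, IsOpen U → ∃ O : Set E, IsOpen O ∧ Subtype.val '' U = O ∩ N := by
    intro U hU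
    obtain ⟨O, hO, rfl⟩ := isOpen_induced_iff.1 hU
    exact ⟨O, hO, by rw [Subtype.image_preimage_coe, Set.inter_comm]⟩
  refine ⟨Fin.cons (Subtype.val '' {z : N | tauPlus φ N L z ≠ ⊤})
    fun i => Subtype.val '' U i, ?_, ?_, ?_, ?_, ?_⟩
  · refine Fin.cases ?_ fun i => ?_
    · exact hopen _ (isOpen_ne.preimage hreg)
    · exact hopen _ (hUo i)
  · intro z hz
    rw [Set.mem_iUnion]
    by_cases h : tauPlus φ N L ⟨z, hz⟩ = ⊤
    · obtain ⟨i, hi⟩ := hcover _ h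
      exact ⟨i.succ, ⟨z, hz⟩, hi, rfl⟩
    · exact ⟨0, ⟨z, hz⟩, h, rfl⟩
  · intro a ha
    refine ⟨⟨a, hLN ha⟩, ?_, rfl⟩
    simp [tauPlus_eq_zero_of_mem (N := N) (z := ⟨a, hLN ha⟩) hφ0 ha]
  · exact exists_deformation_retraction_of_continuous_tauPlus hφc hφ0 hφadd hN hL hLN hexit hreg
  · exact fun i => ⟨hUN i, hUK i⟩
end
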